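/- arXiv:2005.05364 — 3 statements merged into one kernel-verified Lean document; each statement's English description precedes it below -/
import Mathlib

section
/- Under Assumption 1, there exists a Nash equilibrium liquidation vector s** ∈ D of problem (P2) together with equilibrium prices satisfying the consistency conditions q** = g(Σ_{i=1}^n s_i**) and q̄_i** = f̄_i(s**) for every i, i.e., a clearing solution exists. -/
noncomputable section

/-- The domain `D = ∏ [0, aᵢ]` of admissible liquidation vectors. -/
def memD (n : ℕ) (a s : Fin n → ℝ) : Prop := ∀ i, s i ∈ Set.Icc 0 (a i)

/-- Bank `i`'s cost: realized loss from sales plus interest on the borrowed amount. -/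
def obj (n : ℕ) (r : ℝ) (h : Fin n → ℝ) (fbar : Fin n → (Fin n → ℝ) → ℝ)
    (i : Fin n) (s : Fin n → ℝ) : ℝ :=
  s i * (1 - fbar i s) + r * (h i - s i * fbar i s)

/-- Feasibility in problem (P2) with fixed prices `(q, q̄)`. -/
def feasP2 (n : ℕ) (a h : Fin n → ℝ) (q : ℝ) (qb : Fin n → ℝ) (i : Fin n) (x : ℝ) : Prop :=
  x ∈ Set.Icc 0 (a i) ∧ x ≤ h i / qb i ∧ (h i - a i * q) / (qb i - q) ≤ x

/-- `s` is a Nash equilibrium of problem (P2) at fixed prices `(q, q̄)`: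
each bank's action is feasible and optimal given the others' actions, and a bank whose
feasible set is empty (`h i > a i * q̄ i`) liquidates everything. -/
def NashP2 (n : ℕ) (a h : Fin n → ℝ) (r q : ℝ) (qb : Fin n → ℝ)
    (fbar : Fin n → (Fin n → ℝ) → ℝ) (s : Fin n → ℝ) : Prop :=
  ∀ i : Fin n,
    (h i ≤ a i * qb i →
      feasP2 n a h q qb i (s i) ∧
      ∀ x : ℝ, feasP2 n a h q qb i x →
        obj n r h fbar i s ≤ obj n r h fbar i (Function.update s i x)) ∧
    (a i * qb i < h i → s i = a i)

/-- Assumption 1 on the inverse demand functions `f̄ᵢ` and the haircut function `g`. -/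
structure Assumption1 (n : ℕ) (a : Fin n → ℝ) (M : ℝ)
    (fbar : Fin n → (Fin n → ℝ) → ℝ) (g : ℝ → ℝ) : Prop where
  fbar_mem : ∀ i s, memD n a s → fbar i s ∈ Set.Ioc (0 : ℝ) 1
  fbar_cont : ∀ i, ContinuousOn (fbar i) {s | memD n a s}
  fbar_anti : ∀ i s t, memD n a s → memD n a t → (∀ j, s j ≤ t j) → fbar i t ≤ fbar i s
  fbar_one : ∀ i, fbar i (fun _ => 0) = 1
  cash_mono : ∀ i s, memD n a s →
    StrictMonoOn (fun x => x * fbar i (Function.update s i x)) (Set.Icc 0 (a i))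
  cash_concave : ∀ i s, memD n a s →
    ConcaveOn ℝ (Set.Icc 0 (a i)) (fun x => x * fbar i (Function.update s i x))
  g_mem : ∀ x ∈ Set.Icc (0 : ℝ) M, g x ∈ Set.Ioc (0 : ℝ) 1
  g_cont : ContinuousOn g (Set.Icc 0 M)
  g_convex : ConvexOn ℝ (Set.Icc 0 M) g
  g_anti : StrictAntiOn g (Set.Icc 0 M)
  g_lt_fbar : ∀ i s, memD n a s → g (∑ j, s j) < fbar i s
  total_mono : ∀ i s, memD n a s →
    StrictMonoOn
      (fun x => x * fbar i (Function.update s i x)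
        + (a i - x) * g (∑ j, Function.update s i x j)) (Set.Icc 0 (a i))


section Scarf
set_option linter.unusedSectionVars false
variable {ι X : Type*} [Fintype ι] [DecidableEq ι] [Fintype X] [DecidableEq X]

def ScDom (ρ : ι → X → ℕ) (σ : Finset X) (C : Finset ι) : Prop :=
  ∀ y, ∃ i ∈ C, ∀ x ∈ σ, ρ i y ≤ ρ i x

def ScInc (d r : Finset X × Finset ι) : Prop :=
  (∃ x, x ∉ d.1 ∧ r = (insert x d.1, d.2)) ∨ (∃ j ∈ d.2, r = (d.1, d.2.erase j))

def ScKind (ρ : ι → X → ℕ) (τ : Finset X) (D : Finset ι) (k : ι) (r : Finset X × Finset ι) : Prop :=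
  ScDom ρ r.1 r.2 ∧ (r = (τ, D.erase k) ∨
    ∃ x, x ∉ τ ∧ (∀ z ∈ τ, ρ k x < ρ k z) ∧ r = (insert x τ, D))

theorem sc_kind (ρ : ι → X → ℕ) (hρ : ∀ i, Function.Injective (ρ i))
    (τ : Finset X) (D : Finset ι) (k : ι) (m : ι → X) (hk : k ∈ D)
    (hm : ∀ l ∈ D, m l ∈ τ ∧ ∀ x ∈ τ, ρ l (m l) ≤ ρ l x)
    (hsurj : ∀ z ∈ τ, ∃ l ∈ D.erase k, m l = z)
    (hinj : ∀ l ∈ D.erase k, ∀ l' ∈ D.erase k, m l = m l' → l = l')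
    (hdom : ScDom ρ τ D) :
    ∃ r, ScKind ρ τ D k r ∧ ∀ r', ScKind ρ τ D k r' → r' = r := by
  classical
  set Y : Finset X := Finset.univ.filter (fun y => ∀ l ∈ D.erase k, ρ l (m l) < ρ l y) with hY
  have memY : ∀ y, y ∈ Y ↔ ∀ l ∈ D.erase k, ρ l (m l) < ρ l y := by intro y; simp [hY]
  have hxY : ∀ x, x ∉ τ → (∀ z ∈ τ, ρ k x < ρ k z) → ScDom ρ (insert x τ) D → x ∈ Y := by
    intro x hx hxk hd
    rw [memY]
    intro l hl
    have hlD := Finset.mem_of_mem_erase hl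
    obtain ⟨l', hl', h'⟩ := hd (m l)
    have hmlτ := (hm l hlD).1
    have hne : l' ≠ k := by
      rintro rfl
      have := h' x (Finset.mem_insert_self _ _)
      have := hxk _ hmlτ
      omega
    have e : m l' = m l := by
      apply hρ l'
      apply le_antisymm
      · exact (hm l' hl').2 _ hmlτ
      · exact h' _ (Finset.mem_insert_of_mem (hm l' hl').1)
    have e2 := hinj l' (Finset.mem_erase.2 ⟨hne, hl'⟩) l hl e
    subst e2
    refine lt_of_le_of_ne (h' x (Finset.mem_insert_self _ _)) ?_
    intro h
    exact hx (hρ _ h ▸ hmlτ)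
  by_cases hYe : Y.Nonempty
  · obtain ⟨x, hx, hmax⟩ := Y.exists_max_image (ρ k) hYe
    have hx' := (memY x).1 hx
    have hxτ : x ∉ τ := by
      intro h
      obtain ⟨l, hl, rfl⟩ := hsurj x h
      exact lt_irrefl _ (hx' l hl)
    have hxk : ∀ z ∈ τ, ρ k x < ρ k z := by
      obtain ⟨l, hl, h⟩ := hdom x
      have : l = k := by
        by_contra hne
        have h1 := hx' l (Finset.mem_erase.2 ⟨hne, hl⟩)
        have h2 := h _ (hm l hl).1
        omega
      subst this
      intro z hz
      refine lt_of_le_of_ne (h z hz) ?_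
      intro e
      exact hxτ (hρ _ e ▸ hz)
    refine ⟨(insert x τ, D), ⟨?_, Or.inr ⟨x, hxτ, hxk, rfl⟩⟩, ?_⟩
    · intro y
      by_cases hy : y ∈ Y
      · refine ⟨k, hk, ?_⟩
        intro z hz
        rcases Finset.mem_insert.1 hz with rfl | hz
        · exact hmax y hy
        · exact (hmax y hy).trans (hxk z hz).le
      · rw [memY] at hy
        push Not at hy
        obtain ⟨l, hl, h⟩ := hy
        refine ⟨l, Finset.mem_of_mem_erase hl, ?_⟩
        intro z hz
        rcases Finset.mem_insert.1 hz with rfl | hz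
        · exact h.trans (hx' l hl).le
        · exact h.trans ((hm l (Finset.mem_of_mem_erase hl)).2 z hz)
    · rintro r' ⟨hd, rfl | ⟨x', hx'τ, hx'k, rfl⟩⟩
      · exfalso
        obtain ⟨l, hl, h⟩ := hd x
        have h1 := hx' l hl
        have h2 := h _ (hm l (Finset.mem_of_mem_erase hl)).1
        omega
      · have hx'Y := hxY x' hx'τ hx'k hd
        have : x' = x := by
          apply hρ k
          apply le_antisymm (hmax _ hx'Y)
          obtain ⟨l, hl, h⟩ := hd x
          have : l = k := by
            by_contra hne
            have h1 := hx' l (Finset.mem_erase.2 ⟨hne, hl⟩)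
            have h2 := h _ (Finset.mem_insert_of_mem (hm l hl).1)
            omega
          subst this
          exact h _ (Finset.mem_insert_self _ _)
        rw [this]
  · refine ⟨(τ, D.erase k), ⟨?_, Or.inl rfl⟩, ?_⟩
    · intro y
      have hy : y ∉ Y := fun h => hYe ⟨y, h⟩
      rw [memY] at hy
      push Not at hy
      obtain ⟨l, hl, h⟩ := hy
      exact ⟨l, hl, fun z hz => h.trans ((hm l (Finset.mem_of_mem_erase hl)).2 z hz)⟩
    · rintro r' ⟨hd, rfl | ⟨x', hx'τ, hx'k, rfl⟩⟩
      · rfl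
      · exact (hYe ⟨x', hxY x' hx'τ hx'k hd⟩).elim

theorem sc_door (ρ : ι → X → ℕ) (hρ : ∀ i, Function.Injective (ρ i))
    (τ : Finset X) (D : Finset ι) (hτ : τ.Nonempty) (hcard : D.card = τ.card + 1)
    (hdom : ScDom ρ τ D) :
    ∃ r₁ r₂, r₁ ≠ r₂ ∧ ∀ r, (ScDom ρ r.1 r.2 ∧ ScInc (τ, D) r) ↔ (r = r₁ ∨ r = r₂) := by
  classical
  have hm0 : ∀ l, ∃ z, z ∈ τ ∧ ∀ x ∈ τ, ρ l z ≤ ρ l x := by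
    intro l
    obtain ⟨z, hz, h⟩ := τ.exists_min_image (ρ l) hτ
    exact ⟨z, hz, h⟩
  choose m hm using hm0
  have hmu : ∀ l z, z ∈ τ → (∀ x ∈ τ, ρ l z ≤ ρ l x) → m l = z := by
    intro l z hz h
    exact hρ l (le_antisymm ((hm l).2 z hz) (h _ (hm l).1))
  have hs : ∀ z ∈ τ, ∃ l ∈ D, m l = z := by
    intro z hz
    obtain ⟨l, hl, h⟩ := hdom z
    exact ⟨l, hl, hmu l z hz h⟩
  obtain ⟨i, hi, j, hj, hij, hmij⟩ := Finset.exists_ne_map_eq_of_card_lt_of_maps_to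
    (s := D) (t := τ) (f := m) (by omega) (fun l _ => (hm l).1)
  have hcov : ∀ E : Finset ι, (∀ z ∈ τ, ∃ l ∈ E, m l = z) → τ.card ≤ E.card := by
    intro E hE
    refine (Finset.card_le_card ?_).trans (Finset.card_image_le (s := E) (f := m))
    intro z hz
    obtain ⟨l, hl, e⟩ := hE z hz
    exact Finset.mem_image.2 ⟨l, hl, e⟩
  have hinj : ∀ k ∈ D, (∀ z ∈ τ, ∃ l ∈ D.erase k, m l = z) →
      ∀ l ∈ D.erase k, ∀ l' ∈ D.erase k, m l = m l' → l = l' := by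
    intro k hk hE l hl l' hl' e
    by_contra hne
    have := hcov ((D.erase k).erase l) (by
      intro z hz
      obtain ⟨p, hp, e'⟩ := hE z hz
      by_cases hpl : p = l
      · exact ⟨l', Finset.mem_erase.2 ⟨Ne.symm hne, hl'⟩, by rw [← e, ← hpl, e']⟩
      · exact ⟨p, Finset.mem_erase.2 ⟨hpl, hp⟩, e'⟩)
    rw [Finset.card_erase_of_mem hl, Finset.card_erase_of_mem hk] at this
    have : 0 < τ.card := hτ.card_pos
    omega
  have hsi : ∀ z ∈ τ, ∃ l ∈ D.erase i, m l = z := by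
    intro z hz
    obtain ⟨l, hl, e⟩ := hs z hz
    by_cases h : l = i
    · exact ⟨j, Finset.mem_erase.2 ⟨hij.symm, hj⟩, by rw [← hmij, ← h, e]⟩
    · exact ⟨l, Finset.mem_erase.2 ⟨h, hl⟩, e⟩
  have hsj : ∀ z ∈ τ, ∃ l ∈ D.erase j, m l = z := by
    intro z hz
    obtain ⟨l, hl, e⟩ := hs z hz
    by_cases h : l = j
    · exact ⟨i, Finset.mem_erase.2 ⟨hij, hi⟩, by rw [hmij, ← h, e]⟩
    · exact ⟨l, Finset.mem_erase.2 ⟨h, hl⟩, e⟩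
  have hkey : ∀ k ∈ D, (∀ z ∈ τ, ∃ l ∈ D.erase k, m l = z) → k = i ∨ k = j := by
    intro k hk hE
    by_contra hne
    push Not at hne
    exact hij (hinj k hk hE i (Finset.mem_erase.2 ⟨hne.1.symm, hi⟩) j
      (Finset.mem_erase.2 ⟨hne.2.symm, hj⟩) hmij)
  obtain ⟨r₁, h1, u1⟩ := sc_kind ρ hρ τ D i m hi (fun l _ => hm l) hsi (hinj i hi hsi) hdom
  obtain ⟨r₂, h2, u2⟩ := sc_kind ρ hρ τ D j m hj (fun l _ => hm l) hsj (hinj j hj hsj) hdom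
  have hinc : ∀ k ∈ D, ∀ r, ScKind ρ τ D k r → ScInc (τ, D) r := by
    rintro k hk r ⟨_, h | ⟨x, hx, _, h⟩⟩
    · exact Or.inr ⟨k, hk, h⟩
    · exact Or.inl ⟨x, hx, h⟩
  -- an inserted point: elements of τ are minimal for indices avoiding those where x is minimal
  have hins : ∀ x, x ∉ τ → ScDom ρ (insert x τ) D → ∀ z ∈ τ, ∃ l ∈ D, m l = z ∧ ρ l z ≤ ρ l x := by
    intro x hx hd z hz
    obtain ⟨l, hl, h⟩ := hd z
    exact ⟨l, hl, hmu l z hz (fun y hy => h y (Finset.mem_insert_of_mem hy)),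
      h x (Finset.mem_insert_self _ _)⟩
  refine ⟨r₁, r₂, ?_, ?_⟩
  · rintro rfl
    obtain ⟨hd, h1 | ⟨x, hx, hxi, h1⟩⟩ := h1 <;> obtain ⟨_, h2 | ⟨x', hx', hxj, h2⟩⟩ := h2
    · rw [h1] at h2
      have h3 := (Prod.ext_iff.1 h2).2
      simp only at h3
      have : i ∈ D.erase j := Finset.mem_erase.2 ⟨hij, hi⟩
      rw [← h3] at this
      simp at this
    · rw [h1] at h2
      have h3 := (Prod.ext_iff.1 h2).1
      simp only at h3
      exact hx' (h3 ▸ Finset.mem_insert_self _ _)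
    · rw [h1] at h2
      have h3 := (Prod.ext_iff.1 h2).1
      simp only at h3
      exact hx (h3 ▸ Finset.mem_insert_self _ _)
    · rw [h1] at h2
      have h3 := (Prod.ext_iff.1 h2).1
      simp only at h3
      have : x = x' := by
        have h4 : x ∈ insert x' τ := h3 ▸ Finset.mem_insert_self _ _
        rcases Finset.mem_insert.1 h4 with h | h
        · exact h
        · exact (hx h).elim
      subst this
      rw [h1] at hd
      have := hcov ((D.erase i).erase j) (by
        intro z hz
        obtain ⟨l, hl, e, h5⟩ := hins x hx hd z hz
        refine ⟨l, ?_, e⟩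
        simp only [Finset.mem_erase]
        refine ⟨?_, ?_, hl⟩
        · rintro rfl
          have := hxj z hz
          omega
        · rintro rfl
          have := hxi z hz
          omega)
      rw [Finset.card_erase_of_mem (Finset.mem_erase.2 ⟨hij.symm, hj⟩),
        Finset.card_erase_of_mem hi] at this
      have : 0 < τ.card := hτ.card_pos
      omega
  · intro r
    constructor
    · rintro ⟨hd, ⟨x, hx, rfl⟩ | ⟨k, hk, rfl⟩⟩
      · obtain ⟨k, hk, h⟩ := hd x
        simp only at hx h hk hd
        have hxk : ∀ z ∈ τ, ρ k x < ρ k z := by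
          intro z hz
          refine lt_of_le_of_ne (h z (Finset.mem_insert_of_mem hz)) ?_
          intro e
          exact hx (hρ _ e ▸ hz)
        have hk' := hkey k hk (by
          intro z hz
          obtain ⟨l, hl, e, h5⟩ := hins x hx hd z hz
          refine ⟨l, Finset.mem_erase.2 ⟨?_, hl⟩, e⟩
          rintro rfl
          have := hxk z hz
          omega)
        rcases hk' with rfl | rfl
        · exact Or.inl (u1 _ ⟨hd, Or.inr ⟨x, hx, hxk, rfl⟩⟩)
        · exact Or.inr (u2 _ ⟨hd, Or.inr ⟨x, hx, hxk, rfl⟩⟩)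
      · simp only at hd hk
        have hk' := hkey k hk (by
          intro z hz
          obtain ⟨l, hl, h⟩ := hd z
          exact ⟨l, hl, hmu l z hz h⟩)
        rcases hk' with rfl | rfl
        · exact Or.inl (u1 _ ⟨hd, Or.inl rfl⟩)
        · exact Or.inr (u2 _ ⟨hd, Or.inl rfl⟩)
    · rintro (rfl | rfl)
      · exact ⟨h1.1, hinc i hi _ h1⟩
      · exact ⟨h2.1, hinc j hj _ h2⟩

/-- doors of a non-full room, relative to colour `i0`. -/
theorem sc_room (c : X → ι) (i0 : ι) (σ : Finset X) (C : Finset ι) (hcard : σ.card = C.card)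
    (hnf : σ.image c ≠ C) :
    (∀ d : Finset X × Finset ι, ¬ (ScInc d (σ, C) ∧ i0 ∈ d.2 ∧ d.1.image c = d.2.erase i0)) ∨
    ∃ d₁ d₂ : Finset X × Finset ι, d₁ ≠ d₂ ∧
      ∀ d, (ScInc d (σ, C) ∧ i0 ∈ d.2 ∧ d.1.image c = d.2.erase i0) ↔ (d = d₁ ∨ d = d₂) := by
  classical
  have inc_iff : ∀ d : Finset X × Finset ι, ScInc d (σ, C) ↔
      (∃ x ∈ σ, d = (σ.erase x, C)) ∨ (∃ j, j ∉ C ∧ d = (σ, insert j C)) := by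
    rintro ⟨τ, D⟩
    simp only [ScInc, Prod.mk.injEq]
    constructor
    · rintro (⟨x, hx, rfl, rfl⟩ | ⟨j, hj, rfl, rfl⟩)
      · exact Or.inl ⟨x, Finset.mem_insert_self _ _, by rw [Finset.erase_insert hx], rfl⟩
      · exact Or.inr ⟨j, Finset.notMem_erase _ _, rfl, by rw [Finset.insert_erase hj]⟩
    · rintro (⟨x, hx, rfl, rfl⟩ | ⟨j, hj, rfl, rfl⟩)
      · exact Or.inl ⟨x, Finset.notMem_erase _ _, by rw [Finset.insert_erase hx], rfl⟩
      · exact Or.inr ⟨j, Finset.mem_insert_self _ _, rfl, by rw [Finset.erase_insert hj]⟩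
  by_cases hi0 : i0 ∈ C
  swap
  · left
    rintro d ⟨hd, h1, h2⟩
    rcases (inc_iff d).1 hd with ⟨x, hx, rfl⟩ | ⟨j, hj, rfl⟩
    · exact hi0 h1
    · rcases Finset.mem_insert.1 h1 with rfl | h
      · simp only [Finset.erase_insert hj] at h2
        exact hnf h2
      · exact hi0 h
  by_cases h2 : ∃ j, j ∉ C ∧ σ.image c = (insert j C).erase i0
  · right
    obtain ⟨j, hj, hjc⟩ := h2
    have hji : j ≠ i0 := by rintro rfl; exact hj hi0
    have hci : (σ.image c).card = σ.card := by
      rw [hjc, Finset.card_erase_of_mem (Finset.mem_insert_of_mem hi0),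
        Finset.card_insert_of_notMem hj, hcard]
      omega
    have hinj := Finset.card_image_iff.1 hci
    have hjm : j ∈ σ.image c := by
      rw [hjc]; exact Finset.mem_erase.2 ⟨hji, Finset.mem_insert_self _ _⟩
    obtain ⟨x, hx, hxj⟩ := Finset.mem_image.1 hjm
    refine ⟨(σ, insert j C), (σ.erase x, C), ?_, ?_⟩
    · intro e
      have := (Prod.ext_iff.1 e).2
      simp only at this
      exact hj (this ▸ Finset.mem_insert_self _ _)
    · intro d
      rw [inc_iff]
      constructor
      · rintro ⟨⟨y, hy, rfl⟩ | ⟨j', hj', rfl⟩, h3, h4⟩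
        · right
          have : y = x := by
            by_contra hne
            have : c x ∈ (σ.erase y).image c :=
              Finset.mem_image_of_mem _ (Finset.mem_erase.2 ⟨Ne.symm hne, hx⟩)
            simp only at h4
            rw [h4, hxj] at this
            exact hj (Finset.mem_of_mem_erase this)
          rw [this]
        · left
          simp only at h4
          rw [h4] at hjm
          rcases Finset.mem_insert.1 (Finset.mem_of_mem_erase hjm) with h | h
          · rw [h]
          · exact (hj h).elim
      · rintro (rfl | rfl)
        · exact ⟨Or.inr ⟨j, hj, rfl⟩, Finset.mem_insert_of_mem hi0, hjc⟩
        · refine ⟨Or.inl ⟨x, hx, rfl⟩, hi0, ?_⟩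
          simp only
          ext p
          constructor
          · intro hp
            obtain ⟨y, hy, rfl⟩ := Finset.mem_image.1 hp
            have hyσ := Finset.mem_of_mem_erase hy
            have : c y ∈ σ.image c := Finset.mem_image_of_mem _ hyσ
            rw [hjc] at this
            have h5 := Finset.mem_erase.1 this
            refine Finset.mem_erase.2 ⟨h5.1, ?_⟩
            rcases Finset.mem_insert.1 h5.2 with h | h
            · exfalso
              have : y = x := hinj hyσ hx (by rw [h, hxj])
              exact (Finset.mem_erase.1 hy).1 this
            · exact h
          · intro hp
            have h5 := Finset.mem_erase.1 hp
            have : p ∈ σ.image c := by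
              rw [hjc]; exact Finset.mem_erase.2 ⟨h5.1, Finset.mem_insert_of_mem h5.2⟩
            obtain ⟨y, hy, rfl⟩ := Finset.mem_image.1 this
            refine Finset.mem_image_of_mem _ (Finset.mem_erase.2 ⟨?_, hy⟩)
            rintro rfl
            exact hj (hxj ▸ h5.2)
  · by_cases h1 : ∃ x ∈ σ, (σ.erase x).image c = C.erase i0
    · right
      obtain ⟨x, hx, hxc⟩ := h1
      have hσim : σ.image c = insert (c x) (C.erase i0) := by
        rw [← hxc, ← Finset.image_insert, Finset.insert_erase hx]
      have hne0 : c x ≠ i0 := by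
        intro h
        apply hnf
        rw [hσim, h, Finset.insert_erase hi0]
      have hcxC : c x ∈ C := by
        by_contra h
        apply h2
        refine ⟨c x, h, ?_⟩
        rw [hσim, Finset.erase_insert_of_ne hne0]
      have hcx : c x ∈ (σ.erase x).image c := by
        rw [hxc]; exact Finset.mem_erase.2 ⟨hne0, hcxC⟩
      obtain ⟨x', hx', hcx'⟩ := Finset.mem_image.1 hcx
      obtain ⟨hxx', hx'σ⟩ := Finset.mem_erase.1 hx'
      have hxc' : (σ.erase x').image c = C.erase i0 := by
        rw [← hxc]
        ext p
        simp only [Finset.mem_image, Finset.mem_erase]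
        constructor
        · rintro ⟨y, ⟨hy1, hy2⟩, rfl⟩
          by_cases h : y = x
          · exact ⟨x', ⟨hxx', hx'σ⟩, by rw [hcx', h]⟩
          · exact ⟨y, ⟨h, hy2⟩, rfl⟩
        · rintro ⟨y, ⟨hy1, hy2⟩, rfl⟩
          by_cases h : y = x'
          · exact ⟨x, ⟨Ne.symm hxx', hx⟩, by rw [← hcx', h]⟩
          · exact ⟨y, ⟨h, hy2⟩, rfl⟩
      refine ⟨(σ.erase x, C), (σ.erase x', C), ?_, ?_⟩
      · intro e
        have := (Prod.ext_iff.1 e).1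
        simp only at this
        rw [this] at hx'
        simp at hx'
      · intro d
        rw [inc_iff]
        constructor
        · rintro ⟨⟨y, hy, rfl⟩ | ⟨j', hj', rfl⟩, h3, h4⟩
          · simp only at h4
            by_contra hne
            push Not at hne
            have hyx : y ≠ x := by rintro rfl; exact hne.1 rfl
            have hyx' : y ≠ x' := by rintro rfl; exact hne.2 rfl
            have hci : ((σ.erase y).image c).card = (σ.erase y).card := by
              rw [h4, Finset.card_erase_of_mem hi0, Finset.card_erase_of_mem hy, hcard]
            have hinj := Finset.card_image_iff.1 hci
            exact hxx' (hinj (Finset.mem_coe.2 (Finset.mem_erase.2 ⟨hyx'.symm, hx'σ⟩))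
              (Finset.mem_coe.2 (Finset.mem_erase.2 ⟨hyx.symm, hx⟩)) hcx')
          · exact (h2 ⟨j', hj', h4⟩).elim
        · rintro (rfl | rfl)
          · exact ⟨Or.inl ⟨x, hx, rfl⟩, hi0, hxc⟩
          · exact ⟨Or.inl ⟨x', hx'σ, rfl⟩, hi0, hxc'⟩
    · left
      rintro d ⟨hd, h3, h4⟩
      rcases (inc_iff d).1 hd with ⟨x, hx, rfl⟩ | ⟨j, hj, rfl⟩
      · exact h1 ⟨x, hx, h4⟩
      · exact h2 ⟨j, hj, h4⟩

theorem sc_mono (ρ : ι → X → ℕ) {σ : Finset X} {C : Finset ι} {d : Finset X × Finset ι}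
    (h : ScDom ρ σ C) (hi : ScInc d (σ, C)) : ScDom ρ d.1 d.2 := by
  rcases hi with ⟨x, hx, e⟩ | ⟨j, hj, e⟩ <;> obtain ⟨rfl, rfl⟩ := Prod.ext_iff.1 e
  · intro y
    obtain ⟨i, hi, h'⟩ := h y
    exact ⟨i, hi, fun z hz => h' z (Finset.mem_insert_of_mem hz)⟩
  · intro y
    obtain ⟨i, hi, h'⟩ := h y
    exact ⟨i, Finset.mem_of_mem_erase hi, h'⟩

theorem scarf [Nonempty X] [Nonempty ι] (ρ : ι → X → ℕ) (hρ : ∀ i, Function.Injective (ρ i))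
    (c : X → ι) : ∃ (σ : Finset X) (C : Finset ι), ScDom ρ σ C ∧ σ.image c = C := by
  classical
  by_contra hno
  push Not at hno
  obtain ⟨i0⟩ := ‹Nonempty ι›
  let Rooms : Finset (Finset X × Finset ι) :=
    Finset.univ.filter (fun r => ScDom ρ r.1 r.2 ∧ r.1.card = r.2.card)
  let Doors : Finset (Finset X × Finset ι) :=
    Finset.univ.filter (fun d => ScDom ρ d.1 d.2 ∧ d.2.card = d.1.card + 1 ∧
      i0 ∈ d.2 ∧ d.1.image c = d.2.erase i0)
  have hcount := Finset.sum_card_bipartiteAbove_eq_sum_card_bipartiteBelow (s := Doors)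
    (t := Rooms) (ScInc (ι := ι) (X := X))
  have hR : Even (∑ r ∈ Rooms, (Finset.bipartiteBelow ScInc Doors r).card) := by
    apply Finset.even_sum
    rintro ⟨σ, C⟩ hr
    simp only [Rooms, Finset.mem_filter, Finset.mem_univ, true_and] at hr
    have hmem : ∀ d, d ∈ Finset.bipartiteBelow ScInc Doors (σ, C) ↔
        (ScInc d (σ, C) ∧ i0 ∈ d.2 ∧ d.1.image c = d.2.erase i0) := by
      intro d
      simp only [Finset.mem_bipartiteBelow, Doors, Finset.mem_filter, Finset.mem_univ, true_and]
      constructor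
      · rintro ⟨⟨_, _, h1, h2⟩, h3⟩
        exact ⟨h3, h1, h2⟩
      · rintro ⟨h3, h1, h2⟩
        refine ⟨⟨sc_mono ρ hr.1 h3, ?_, h1, h2⟩, h3⟩
        rcases h3 with ⟨x, hx, e⟩ | ⟨j, hj, e⟩ <;> obtain ⟨rfl, rfl⟩ := Prod.ext_iff.1 e
        · have := hr.2
          rw [Finset.card_insert_of_notMem hx] at this
          exact this.symm
        · have := hr.2
          simp only at this
          rw [Finset.card_erase_of_mem hj] at this
          have : 0 < d.2.card := Finset.card_pos.2 ⟨j, hj⟩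
          omega
    rcases sc_room c i0 σ C hr.2 (hno σ C hr.1) with h | ⟨d₁, d₂, hne, h⟩
    · have : Finset.bipartiteBelow ScInc Doors (σ, C) = ∅ := by
        ext d; rw [hmem]; simp only [Finset.notMem_empty, iff_false]; exact h d
      rw [this]; simp
    · have : Finset.bipartiteBelow ScInc Doors (σ, C) = {d₁, d₂} := by
        ext d; rw [hmem, h]; simp
      rw [this, Finset.card_pair hne]; exact even_two
  have hd0 : ((∅, {i0}) : Finset X × Finset ι) ∈ Doors := by
    refine Finset.mem_filter.2 ⟨Finset.mem_univ _, ?_, by simp, by simp, by simp⟩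
    intro y
    exact ⟨i0, by simp, by simp⟩
  have hD1 : (Finset.bipartiteAbove ScInc Rooms ((∅, {i0}) : Finset X × Finset ι)).card = 1 := by
    obtain ⟨x, _, hx⟩ := (Finset.univ : Finset X).exists_max_image (ρ i0) Finset.univ_nonempty
    rw [Finset.card_eq_one]
    refine ⟨({x}, {i0}), ?_⟩
    ext r
    simp only [Finset.mem_bipartiteAbove, Rooms, Finset.mem_filter, Finset.mem_univ, true_and,
      Finset.mem_singleton]
    constructor
    · rintro ⟨⟨hd, hc⟩, ⟨y, hy, rfl⟩ | ⟨j, hj, rfl⟩⟩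
      · obtain ⟨i, hi, h⟩ := hd x
        simp only [Finset.mem_singleton] at hi
        subst hi
        have h1 := h y (Finset.mem_insert_self _ _)
        have h2 := hx y (Finset.mem_univ _)
        have : x = y := hρ i (le_antisymm h1 h2)
        subst this
        rfl
      · simp only [Finset.mem_singleton] at hj
        subst hj
        obtain ⟨i, hi, h⟩ := hd x
        simp at hi
    · rintro rfl
      refine ⟨⟨?_, by simp⟩, Or.inl ⟨x, by simp, rfl⟩⟩
      intro y
      exact ⟨i0, by simp, fun z hz => by
        simp only [Finset.mem_singleton] at hz; subst hz; exact hx y (Finset.mem_univ _)⟩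
  have hD2 : Even (∑ d ∈ Doors.erase (∅, {i0}), (Finset.bipartiteAbove ScInc Rooms d).card) := by
    apply Finset.even_sum
    rintro ⟨τ, D⟩ hd
    obtain ⟨hne, hd⟩ := Finset.mem_erase.1 hd
    simp only [Doors, Finset.mem_filter, Finset.mem_univ, true_and] at hd
    obtain ⟨h1, h2, h3, h4⟩ := hd
    have hτ : τ.Nonempty := by
      rw [Finset.nonempty_iff_ne_empty]
      rintro rfl
      apply hne
      simp only [Finset.card_empty, zero_add] at h2
      obtain ⟨k, rfl⟩ := Finset.card_eq_one.1 h2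
      simp only [Finset.mem_singleton] at h3
      rw [h3]
    obtain ⟨r₁, r₂, hr, h⟩ := sc_door ρ hρ τ D hτ h2 h1
    have : Finset.bipartiteAbove ScInc Rooms (τ, D) = {r₁, r₂} := by
      ext r
      simp only [Finset.mem_bipartiteAbove, Rooms, Finset.mem_filter, Finset.mem_univ, true_and,
        Finset.mem_insert, Finset.mem_singleton]
      rw [← h]
      constructor
      · rintro ⟨⟨a, b⟩, c⟩; exact ⟨a, c⟩
      · rintro ⟨a, b⟩
        refine ⟨⟨a, ?_⟩, b⟩
        rcases b with ⟨x, hx, rfl⟩ | ⟨j, hj, rfl⟩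
        · simp only at hx ⊢
          rw [Finset.card_insert_of_notMem hx, h2]
        · simp only at hj ⊢
          rw [Finset.card_erase_of_mem hj, h2]; rfl
    rw [this, Finset.card_pair hr]; exact even_two
  rw [← Finset.add_sum_erase _ _ hd0, hD1] at hcount
  rw [← hcount] at hR
  have := hR.add hD2
  rw [Nat.even_iff] at hR hD2
  omega

theorem sc_grid [Nonempty ι] (N : ℕ) (c : (ι → ℕ) → ι) :
    ∃ (σ : Finset (ι → ℕ)) (C : Finset ι), σ.Nonempty ∧ σ.image c = C ∧
      (∀ v ∈ σ, ∑ i, v i = N) ∧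
      (∀ v ∈ σ, ∀ i, i ∉ C → v i < Fintype.card ι) ∧
      (∀ v ∈ σ, ∀ w ∈ σ, ∀ i, v i < w i + Fintype.card ι) := by
  classical
  let A : Finset (ι → ℕ) := Finset.piAntidiag Finset.univ N
  have hA : ∀ v, v ∈ A ↔ ∑ i, v i = N := by intro v; simp [A]
  obtain ⟨i0⟩ := ‹Nonempty ι›
  have : Nonempty ι := ⟨i0⟩
  have : Nonempty A := ⟨⟨Pi.single i0 N, by rw [hA]; simp⟩⟩
  let e := Fintype.equivFin A
  let K := Fintype.card A
  have he : ∀ v : A, (e v : ℕ) < K := fun v => (e v).2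
  let ρ : ι → A → ℕ := fun i v => v.1 i * K + e v
  have hlt : ∀ i (v w : A), v.1 i < w.1 i → ρ i v < ρ i w := by
    intro i v w h
    have h1 := he v
    have h2 : (v.1 i + 1) * K ≤ w.1 i * K := Nat.mul_le_mul_right _ h
    simp only [ρ]
    rw [Nat.add_mul] at h2
    omega
  have hρ : ∀ i, Function.Injective (ρ i) := by
    intro i v w h
    rcases lt_trichotomy (v.1 i) (w.1 i) with h' | h' | h'
    · exact absurd h (hlt i v w h').ne
    · simp only [ρ, h', add_right_inj] at h
      exact e.injective (Fin.ext h)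
    · exact absurd h (hlt i w v h').ne'
  obtain ⟨σ, C, hd, hc⟩ := scarf ρ hρ (fun v => c v.1)
  have hCne : C.Nonempty := by
    obtain ⟨i, hi, _⟩ := hd (Classical.arbitrary A)
    exact ⟨i, hi⟩
  have hσne : σ.Nonempty := by
    rw [← hc] at hCne
    exact Finset.image_nonempty.1 hCne
  have hm0 : ∀ i, ∃ v ∈ σ, ∀ w ∈ σ, v.1 i ≤ w.1 i := fun i =>
    σ.exists_min_image (fun v => v.1 i) hσne
  choose μ hμ hμm using hm0
  have hsum : N < ∑ i ∈ C, ((μ i).1 i + 1) := by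
    by_contra hle
    push Not at hle
    obtain ⟨i1, hi1⟩ := hCne
    let y : ι → ℕ := fun i => (if i ∈ C then (μ i).1 i + 1 else 0) +
      (if i = i1 then N - ∑ i ∈ C, ((μ i).1 i + 1) else 0)
    have hy : ∑ i, y i = N := by
      simp only [y]
      rw [Finset.sum_add_distrib, Finset.sum_ite_eq' Finset.univ i1, ← Finset.sum_filter]
      simp only [Finset.filter_mem_eq_inter, Finset.univ_inter, Finset.mem_univ, if_true]
      omega
    obtain ⟨i, hi, h⟩ := hd ⟨y, (hA y).2 hy⟩
    have h1 := h _ (hμ i)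
    have h2 := hlt i (μ i) ⟨y, (hA y).2 hy⟩ (by simp only [y, hi, if_true]; omega)
    omega
  have hsum' : N < ∑ i ∈ C, (μ i).1 i + Fintype.card ι := by
    rw [Finset.sum_add_distrib] at hsum
    have : C.card ≤ Fintype.card ι := Finset.card_le_univ C
    simp only [Finset.sum_const, smul_eq_mul, mul_one] at hsum
    omega
  have hout : ∀ v ∈ σ, ∀ i, i ∉ C → v.1 i < Fintype.card ι := by
    intro v hv i hi
    have h1 : ∑ j ∈ insert i C, v.1 j ≤ ∑ j, v.1 j :=
      Finset.sum_le_sum_of_subset (Finset.subset_univ _)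
    rw [Finset.sum_insert hi, (hA v.1).1 v.2] at h1
    have h2 : ∑ j ∈ C, (μ j).1 j ≤ ∑ j ∈ C, v.1 j :=
      Finset.sum_le_sum (fun j _ => hμm j v hv)
    omega
  refine ⟨σ.image Subtype.val, C, hσne.image _, ?_, ?_, ?_, ?_⟩
  · rw [Finset.image_image]; exact hc
  · intro v hv
    obtain ⟨v, hv', rfl⟩ := Finset.mem_image.1 hv
    exact (hA v.1).1 v.2
  · intro v hv
    obtain ⟨v, hv', rfl⟩ := Finset.mem_image.1 hv
    exact hout v hv'
  · intro v hv w hw i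
    obtain ⟨v, hv', rfl⟩ := Finset.mem_image.1 hv
    obtain ⟨w, hw', rfl⟩ := Finset.mem_image.1 hw
    by_cases hi : i ∈ C
    · have h1 : ∑ j ∈ C, v.1 j ≤ ∑ j, v.1 j :=
        Finset.sum_le_sum_of_subset (Finset.subset_univ _)
      rw [(hA v.1).1 v.2, ← Finset.add_sum_erase _ _ hi] at h1
      rw [← Finset.add_sum_erase _ _ hi] at hsum'
      have h2 : ∑ j ∈ C.erase i, (μ j).1 j ≤ ∑ j ∈ C.erase i, v.1 j :=
        Finset.sum_le_sum (fun j _ => hμm j v hv')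
      have := hμm i w hw'
      omega
    · have := hout v hv' i hi
      omega

theorem brouwer_approx [Nonempty ι] (f : (ι → ℝ) → (ι → ℝ))
    (hf : ContinuousOn f (stdSimplex ℝ ι)) (hmap : Set.MapsTo f (stdSimplex ℝ ι) (stdSimplex ℝ ι))
    (ε : ℝ) (hε : 0 < ε) : ∃ x ∈ stdSimplex ℝ ι, ∀ i, x i - ε ≤ f x i := by
  classical
  have huc := (isCompact_stdSimplex ℝ ι).uniformContinuousOn_of_continuous hf
  rw [Metric.uniformContinuousOn_iff] at huc
  obtain ⟨δ, hδ, huc⟩ := huc (ε / 2) (by positivity)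
  obtain ⟨N, hN⟩ := exists_nat_gt ((Fintype.card ι : ℝ) / min δ (ε / 2))
  have hmin : 0 < min δ (ε / 2) := lt_min hδ (by positivity)
  have hcardpos : (0 : ℝ) < Fintype.card ι := by exact_mod_cast Fintype.card_pos
  have hN0 : (0 : ℝ) < N := lt_trans (by positivity) hN
  have hNs : (Fintype.card ι : ℝ) / N < min δ (ε / 2) := by
    rw [div_lt_iff₀ hmin] at hN
    rw [div_lt_iff₀ hN0]; linarith
  let p : (ι → ℕ) → (ι → ℝ) := fun v i => (v i : ℝ) / N
  have hp : ∀ v : ι → ℕ, ∑ i, v i = N → p v ∈ stdSimplex ℝ ι := by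
    intro v hv
    refine ⟨fun i => by positivity, ?_⟩
    simp only [p]
    rw [← Finset.sum_div, ← Nat.cast_sum, hv, div_self hN0.ne']
  have hcol : ∀ v : ι → ℕ, ∃ i, ∑ i, v i = N → p v i ≤ f (p v) i := by
    intro v
    by_cases hv : ∑ i, v i = N
    · by_contra! hcon
      have h1 : ∑ i, f (p v) i < ∑ i, p v i :=
        Finset.sum_lt_sum_of_nonempty Finset.univ_nonempty (fun i _ => (hcon i).2)
      rw [(hmap (hp v hv)).2, (hp v hv).2] at h1
      exact lt_irrefl _ h1
    · exact ⟨Classical.arbitrary ι, fun h => (hv h).elim⟩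
  choose c hc using hcol
  obtain ⟨σ, C, ⟨x0, hx0⟩, hcC, hs, hout, hclose⟩ := sc_grid N c
  have hx0S := hp x0 (hs x0 hx0)
  refine ⟨p x0, hx0S, ?_⟩
  have hd : ∀ w ∈ σ, ∀ i, |p x0 i - p w i| ≤ (Fintype.card ι : ℝ) / N := by
    intro w hw i
    simp only [p]
    rw [← sub_div, abs_div, abs_of_pos hN0]
    gcongr
    have h1 : (x0 i : ℝ) < w i + Fintype.card ι := by exact_mod_cast hclose x0 hx0 w hw i
    have h2 : (w i : ℝ) < x0 i + Fintype.card ι := by exact_mod_cast hclose w hw x0 hx0 i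
    rw [abs_le]; constructor <;> linarith
  intro i
  by_cases hi : i ∈ C
  · rw [← hcC] at hi
    obtain ⟨w, hw, rfl⟩ := Finset.mem_image.1 hi
    have h1 := hc w (hs w hw)
    have h2 := hd w hw (c w)
    have h3 : dist (p x0) (p w) < δ := by
      rw [dist_pi_lt_iff hδ]
      intro j
      rw [Real.dist_eq]
      exact (hd w hw j).trans_lt (hNs.trans_le (min_le_left _ _))
    have h4 := huc _ hx0S _ (hp w (hs w hw)) h3
    have h5 := (dist_le_pi_dist (f (p x0)) (f (p w)) (c w)).trans_lt h4
    rw [Real.dist_eq, abs_lt] at h5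
    rw [abs_le] at h2
    have := hNs.trans_le (min_le_right _ _)
    linarith [h5.1, h2.2]
  · have h1 : (x0 i : ℝ) < Fintype.card ι := by exact_mod_cast hout x0 hx0 i hi
    have h2 : p x0 i ≤ (Fintype.card ι : ℝ) / N := by simp only [p]; gcongr
    have h3 := (hmap hx0S).1 i
    have := hNs.trans_le (min_le_right _ _)
    linarith

theorem brouwer_simplex [Nonempty ι] (f : (ι → ℝ) → (ι → ℝ))
    (hf : ContinuousOn f (stdSimplex ℝ ι))
    (hmap : Set.MapsTo f (stdSimplex ℝ ι) (stdSimplex ℝ ι)) :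
    ∃ x ∈ stdSimplex ℝ ι, f x = x := by
  classical
  have hne : (stdSimplex ℝ ι).Nonempty := by
    obtain ⟨x, hx, _⟩ := brouwer_approx f hf hmap 1 one_pos
    exact ⟨x, hx⟩
  have hG : ContinuousOn (fun x => ∑ i, max 0 (x i - f x i)) (stdSimplex ℝ ι) := by
    have : ∀ i, ContinuousOn (fun x => f x i) (stdSimplex ℝ ι) := fun i =>
      (continuous_apply i).comp_continuousOn hf
    fun_prop
  obtain ⟨x, hx, hmin⟩ := (isCompact_stdSimplex ℝ ι).exists_isMinOn hne hG
  refine ⟨x, hx, ?_⟩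
  have h0 : ∑ i, max 0 (x i - f x i) ≤ 0 := by
    apply le_of_forall_pos_le_add
    intro ε hε
    have hcardpos : (0 : ℝ) < Fintype.card ι := by exact_mod_cast Fintype.card_pos
    obtain ⟨y, hy, h⟩ := brouwer_approx f hf hmap (ε / Fintype.card ι) (by positivity)
    have h1 : ∑ i, max 0 (x i - f x i) ≤ ∑ i, max 0 (y i - f y i) := hmin hy
    have h2 : ∑ i, max 0 (y i - f y i) ≤ ∑ i : ι, ε / Fintype.card ι := by
      apply Finset.sum_le_sum
      intro i _
      apply max_le (by positivity)
      linarith [h i]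
    rw [Finset.sum_const, Finset.card_univ, nsmul_eq_mul, mul_div_cancel₀ _ hcardpos.ne'] at h2
    linarith
  have h1 : ∀ i, x i ≤ f x i := by
    intro i
    have h2 : max 0 (x i - f x i) ≤ ∑ i, max 0 (x i - f x i) :=
      Finset.single_le_sum (f := fun i => max 0 (x i - f x i))
        (fun j _ => le_max_left _ _) (Finset.mem_univ i)
    have := le_max_right 0 (x i - f x i)
    linarith
  have h2 : ∑ i, x i = ∑ i, f x i := by rw [hx.2, (hmap hx).2]
  have h3 := (Finset.sum_eq_sum_iff_of_le (fun i _ => h1 i)).1 h2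
  funext i
  exact (h3 i (Finset.mem_univ i)).symm
end Scarf

theorem brouwer_box (n : ℕ) (a : Fin n → ℝ) (ha : ∀ i, 0 < a i) (T : (Fin n → ℝ) → (Fin n → ℝ))
    (hT : ContinuousOn T {s | ∀ i, s i ∈ Set.Icc 0 (a i)})
    (hmap : ∀ s, (∀ i, s i ∈ Set.Icc 0 (a i)) → ∀ i, T s i ∈ Set.Icc 0 (a i)) :
    ∃ s, (∀ i, s i ∈ Set.Icc 0 (a i)) ∧ T s = s := by
  classical
  set R : ℝ := 1 + ∑ i, a i with hR
  have hRpos : 0 < R := by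
    have : 0 ≤ ∑ i, a i := Finset.sum_nonneg (fun i _ => (ha i).le)
    linarith
  let P : (Option (Fin n) → ℝ) → (Fin n → ℝ) := fun x i => min (R * x (some i)) (a i)
  have hP : ∀ x ∈ stdSimplex ℝ (Option (Fin n)), ∀ i, P x i ∈ Set.Icc 0 (a i) := by
    intro x hx i
    exact ⟨le_min (mul_nonneg hRpos.le (hx.1 _)) (ha i).le, min_le_right _ _⟩
  let f : (Option (Fin n) → ℝ) → (Option (Fin n) → ℝ) := fun x o =>
    o.elim (1 - ∑ i, T (P x) i / R) (fun i => T (P x) i / R)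
  have hPc : Continuous P := by
    refine continuous_pi fun i => ?_
    fun_prop
  have hTP : ContinuousOn (fun x => T (P x)) (stdSimplex ℝ (Option (Fin n))) :=
    hT.comp hPc.continuousOn (fun x hx => hP x hx)
  have hTPi : ∀ i, ContinuousOn (fun x => T (P x) i) (stdSimplex ℝ (Option (Fin n))) := fun i =>
    (continuous_apply i).comp_continuousOn hTP
  have hf : ContinuousOn f (stdSimplex ℝ (Option (Fin n))) := by
    refine continuousOn_pi.2 fun o => ?_
    cases o with
    | none =>
      simp only [f, Option.elim_none]
      exact continuousOn_const.sub
        (continuousOn_finsetSum _ (fun i _ => (hTPi i).div_const R))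
    | some i =>
      simp only [f, Option.elim_some]
      exact (hTPi i).div_const R
  have hfm : Set.MapsTo f (stdSimplex ℝ (Option (Fin n))) (stdSimplex ℝ (Option (Fin n))) := by
    intro x hx
    have hb := hmap (P x) (hP x hx)
    refine ⟨?_, ?_⟩
    · intro o
      cases o with
      | none =>
        simp only [f, Option.elim_none]
        rw [← Finset.sum_div, sub_nonneg, div_le_one hRpos]
        have : ∑ i, T (P x) i ≤ ∑ i, a i := Finset.sum_le_sum (fun i _ => (hb i).2)
        linarith
      | some i =>
        simp only [f, Option.elim_some]
        exact div_nonneg (hb i).1 hRpos.le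
    · rw [Fintype.sum_option]
      simp [f]
  obtain ⟨x, hx, hfx⟩ := brouwer_simplex f hf hfm
  have hb := hmap (P x) (hP x hx)
  refine ⟨P x, hP x hx, ?_⟩
  funext i
  have h1 : T (P x) i / R = x (some i) := congrFun hfx (some i)
  have h2 : R * x (some i) = T (P x) i := by rw [← h1]; field_simp
  simp only [P] at h2 ⊢
  rw [h2]
  exact (min_eq_left (hb i).2).symm


theorem argmin_cont {E : Type*} [TopologicalSpace E] (A : ℝ) (Φ : E → ℝ → ℝ) (lo hi t : E → ℝ)
    (hlo : Continuous lo) (hhi : Continuous hi) (hlo0 : ∀ s, 0 ≤ lo s) (hlh : ∀ s, lo s ≤ hi s)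
    (hhiA : ∀ s, hi s ≤ A)
    (hΦ : Continuous (fun p : Set.Icc (0 : ℝ) A × E => Φ p.2 p.1))
    (ht : ∀ s, t s ∈ Set.Icc (lo s) (hi s))
    (htm : ∀ s, ∀ z ∈ Set.Icc (lo s) (hi s), Φ s (t s) ≤ Φ s z)
    (huniq : ∀ s, ∀ y ∈ Set.Icc (lo s) (hi s), (∀ z ∈ Set.Icc (lo s) (hi s), Φ s y ≤ Φ s z) →
      y = t s) : Continuous t := by
  have htK : ∀ s, t s ∈ Set.Icc (0 : ℝ) A := fun s =>
    ⟨(hlo0 s).trans (ht s).1, (ht s).2.trans (hhiA s)⟩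
  let t' : E → Set.Icc (0 : ℝ) A := fun s => ⟨t s, htK s⟩
  suffices h : Continuous t' from continuous_subtype_val.comp h
  let pr : ℝ → E → Set.Icc (0 : ℝ) A := fun z s => ⟨max (lo s) (min z (hi s)),
    (hlo0 s).trans (le_max_left _ _),
    max_le ((hlh s).trans (hhiA s)) ((min_le_right _ _).trans (hhiA s))⟩
  have hpr : ∀ z, Continuous (pr z) := fun z =>
    Continuous.subtype_mk (hlo.max (continuous_const.min hhi)) _
  let G : Set (Set.Icc (0 : ℝ) A × E) :=
    {p | lo p.2 ≤ p.1 ∧ (p.1 : ℝ) ≤ hi p.2 ∧ ∀ z : ℝ, Φ p.2 p.1 ≤ Φ p.2 (pr z p.2)}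
  have hG : IsClosed G := by
    have c1 : Continuous (fun p : Set.Icc (0 : ℝ) A × E => (p.1 : ℝ)) :=
      continuous_subtype_val.comp continuous_fst
    refine (isClosed_le (hlo.comp continuous_snd) c1).inter
      ((isClosed_le c1 (hhi.comp continuous_snd)).inter ?_)
    have e : {p : Set.Icc (0 : ℝ) A × E | ∀ z : ℝ, Φ p.2 p.1 ≤ Φ p.2 (pr z p.2)} =
        ⋂ z : ℝ, {p | Φ p.2 p.1 ≤ Φ p.2 (pr z p.2)} := by
      ext p; simp
    change IsClosed {p : Set.Icc (0 : ℝ) A × E | ∀ z : ℝ, Φ p.2 p.1 ≤ Φ p.2 (pr z p.2)}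
    rw [e]
    refine isClosed_iInter fun z => isClosed_le hΦ ?_
    exact hΦ.comp (((hpr z).comp continuous_snd).prodMk continuous_snd)
  have hGt : ∀ p, p ∈ G ↔ p.1 = t' p.2 := by
    rintro ⟨y, s⟩
    constructor
    · rintro ⟨h1, h2, h3⟩
      refine Subtype.ext (huniq s y ⟨h1, h2⟩ ?_)
      intro z hz
      have := h3 z
      simp only [pr] at this
      rwa [min_eq_left hz.2, max_eq_right hz.1] at this
    · intro h
      simp only at h
      subst h
      refine ⟨(ht s).1, (ht s).2, fun z => ?_⟩
      exact htm s _ ⟨le_max_left _ _, max_le (hlh s) (min_le_right _ _)⟩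
  rw [continuous_iff_isClosed]
  intro F hF
  have : t' ⁻¹' F = Prod.snd '' (G ∩ Prod.fst ⁻¹' F) := by
    ext s
    constructor
    · intro hs
      exact ⟨(t' s, s), ⟨(hGt _).2 rfl, hs⟩, rfl⟩
    · rintro ⟨⟨y, s'⟩, ⟨h1, h2⟩, rfl⟩
      have h3 := (hGt _).1 h1
      simp only at h3
      subst h3
      exact h2
  rw [this]
  exact isClosedMap_snd_of_compactSpace _ (hG.inter (hF.preimage continuous_fst))

theorem prox_uniq (A : ℝ) (ψ : ℝ → ℝ) (hψ : ConvexOn ℝ (Set.Icc 0 A) ψ) (l u b y y' : ℝ)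
    (hl : 0 ≤ l) (hu : u ≤ A) (hy : y ∈ Set.Icc l u) (hy' : y' ∈ Set.Icc l u)
    (hm : ∀ z ∈ Set.Icc l u, ψ y + (y - b) ^ 2 ≤ ψ z + (z - b) ^ 2)
    (hm' : ∀ z ∈ Set.Icc l u, ψ y' + (y' - b) ^ 2 ≤ ψ z + (z - b) ^ 2) : y = y' := by
  have h1 := hψ.2 (⟨hl.trans hy.1, hy.2.trans hu⟩ : y ∈ Set.Icc 0 A)
    (⟨hl.trans hy'.1, hy'.2.trans hu⟩ : y' ∈ Set.Icc 0 A) (by norm_num : (0 : ℝ) ≤ 1 / 2)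
    (by norm_num : (0 : ℝ) ≤ 1 / 2) (by norm_num)
  simp only [smul_eq_mul] at h1
  have h2 := hm (1 / 2 * y + 1 / 2 * y') ⟨by linarith [hy.1, hy'.1], by linarith [hy.2, hy'.2]⟩
  have h3 := hm' (1 / 2 * y + 1 / 2 * y') ⟨by linarith [hy.1, hy'.1], by linarith [hy.2, hy'.2]⟩
  have h4 : (y - y') ^ 2 ≤ 0 := by nlinarith
  have h5 : y - y' = 0 := by
    have := le_antisymm h4 (sq_nonneg _)
    exact pow_eq_zero_iff (two_ne_zero) |>.1 this
  linarith

theorem prox_fix (A : ℝ) (ψ : ℝ → ℝ) (hψ : ConvexOn ℝ (Set.Icc 0 A) ψ) (l u y : ℝ)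
    (hl : 0 ≤ l) (hu : u ≤ A) (hy : y ∈ Set.Icc l u)
    (hm : ∀ z ∈ Set.Icc l u, ψ y + (y - y) ^ 2 ≤ ψ z + (z - y) ^ 2) :
    ∀ z ∈ Set.Icc l u, ψ y ≤ ψ z := by
  intro z hz
  have key : ∀ t : ℝ, 0 < t → t ≤ 1 → ψ y ≤ ψ z + t * (z - y) ^ 2 := by
    intro t ht ht1
    have h1 := hψ.2 (⟨hl.trans hy.1, hy.2.trans hu⟩ : y ∈ Set.Icc 0 A)
      (⟨hl.trans hz.1, hz.2.trans hu⟩ : z ∈ Set.Icc 0 A) (by linarith : 0 ≤ 1 - t) ht.le (by ring)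
    simp only [smul_eq_mul] at h1
    have h2 := hm ((1 - t) * y + t * z)
      ⟨by nlinarith [hy.1, hz.1], by nlinarith [hy.2, hz.2]⟩
    have h3 : t * ψ y ≤ t * (ψ z + t * (z - y) ^ 2) := by nlinarith
    exact le_of_mul_le_mul_left h3 ht
  apply le_of_forall_pos_le_add
  intro ε hε
  have hpos : 0 < (z - y) ^ 2 + ε := by positivity
  have h1 := key (ε / ((z - y) ^ 2 + ε)) (by positivity) (by
    rw [div_le_one hpos]; nlinarith [sq_nonneg (z - y)])
  have h2 : ε / ((z - y) ^ 2 + ε) * (z - y) ^ 2 ≤ ε := by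
    rw [div_mul_eq_mul_div, div_le_iff₀ hpos]; nlinarith [sq_nonneg (z - y)]
  linarith

theorem clearing_solution_exists
    (n : ℕ) (a h : Fin n → ℝ) (r M : ℝ)
    (fbar : Fin n → (Fin n → ℝ) → ℝ) (g : ℝ → ℝ)
    (ha : ∀ i, 0 < a i) (hh : ∀ i, 0 < h i) (hr : 0 ≤ r)
    (hM : ∑ i, a i ≤ M)
    (hA : Assumption1 n a M fbar g) :
    ∃ s : Fin n → ℝ, memD n a s ∧
      NashP2 n a h r (g (∑ i, s i)) (fun i => fbar i s) fbar s := by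
  classical
  let S : Set (Fin n → ℝ) := {s | memD n a s}
  have hupd : ∀ s ∈ S, ∀ i, ∀ x ∈ Set.Icc 0 (a i), Function.update s i x ∈ S := by
    intro s hs i x hx j
    by_cases hj : j = i
    · subst hj; simpa using hx
    · simpa [Function.update_of_ne hj] using hs j
  have hsumM : ∀ s ∈ S, ∑ i, s i ∈ Set.Icc 0 M := fun s hs =>
    ⟨Finset.sum_nonneg fun i _ => (hs i).1,
      (Finset.sum_le_sum fun i _ => (hs i).2).trans hM⟩
  let q : S → ℝ := fun s => g (∑ i, s.1 i)
  let qb : Fin n → S → ℝ := fun i s => fbar i s.1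
  have hq : Continuous q := by
    refine hA.g_cont.comp_continuous ?_ (fun s => hsumM s.1 s.2)
    exact continuous_finsetSum _ (fun i _ => (continuous_apply i).comp continuous_subtype_val)
  have hqb : ∀ i, Continuous (qb i) := fun i =>
    (hA.fbar_cont i).comp_continuous continuous_subtype_val (fun s => s.2)
  have hqb0 : ∀ i s, 0 < qb i s := fun i s => (hA.fbar_mem i s.1 s.2).1
  have hqqb : ∀ i s, 0 < qb i s - q s := fun i s => sub_pos.2 (hA.g_lt_fbar i s.1 s.2)
  have hq0 : ∀ s, 0 < q s := fun s => (hA.g_mem _ (hsumM s.1 s.2)).1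
  let lo : Fin n → S → ℝ := fun i s => min (a i) (max 0 ((h i - a i * q s) / (qb i s - q s)))
  let hi : Fin n → S → ℝ := fun i s => min (a i) (h i / qb i s)
  have hloc : ∀ i, Continuous (lo i) := fun i =>
    continuous_const.min (continuous_const.max
      ((continuous_const.sub (continuous_const.mul hq)).div ((hqb i).sub hq)
        (fun s => (hqqb i s).ne')))
  have hhic : ∀ i, Continuous (hi i) := fun i =>
    continuous_const.min (continuous_const.div (hqb i) (fun s => (hqb0 i s).ne'))
  have hlo0 : ∀ i s, 0 ≤ lo i s := fun i s => le_min (ha i).le (le_max_left _ _)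
  have hhia : ∀ i s, hi i s ≤ a i := fun i s => min_le_left _ _
  have hlhfeas : ∀ i s, h i ≤ a i * qb i s →
      (h i - a i * q s) / (qb i s - q s) ≤ a i ∧
      (h i - a i * q s) / (qb i s - q s) ≤ h i / qb i s ∧ h i / qb i s ≤ a i := by
    intro i s hf
    refine ⟨?_, ?_, ?_⟩
    · rw [div_le_iff₀ (hqqb i s)]; linarith
    · rw [div_le_div_iff₀ (hqqb i s) (hqb0 i s)]
      nlinarith [mul_le_mul_of_nonneg_left hf (hq0 s).le]
    · rw [div_le_iff₀ (hqb0 i s)]; exact hf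
  have hlh : ∀ i s, lo i s ≤ hi i s := by
    intro i s
    by_cases hf : h i ≤ a i * qb i s
    · obtain ⟨h1, h2, h3⟩ := hlhfeas i s hf
      refine le_min (min_le_left _ _) ((min_le_right _ _).trans (max_le ?_ h2))
      exact (div_pos (hh i) (hqb0 i s)).le
    · push Not at hf
      refine le_min (min_le_left _ _) ((min_le_left _ _).trans ?_)
      rw [le_div_iff₀ (hqb0 i s)]; exact hf.le
  let ψ : Fin n → S → ℝ → ℝ := fun i s x => x - (1 + r) * (x * fbar i (Function.update s.1 i x))
  have hψ : ∀ i s, ConvexOn ℝ (Set.Icc 0 (a i)) (ψ i s) := by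
    intro i s
    exact (convexOn_id (convex_Icc _ _)).sub ((hA.cash_concave i s.1 s.2).smul (by linarith : 0 ≤ 1 + r))
  let Φ : Fin n → S → ℝ → ℝ := fun i s x => ψ i s x + (x - s.1 i) ^ 2
  have hΦ : ∀ i, Continuous (fun p : Set.Icc (0 : ℝ) (a i) × S => Φ i p.2 p.1) := by
    intro i
    have c0 : Continuous (fun p : Set.Icc (0 : ℝ) (a i) × S => (p.1 : ℝ)) :=
      continuous_subtype_val.comp continuous_fst
    have c1 : Continuous (fun p : Set.Icc (0 : ℝ) (a i) × S => p.2.1) :=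
      continuous_subtype_val.comp continuous_snd
    have c2 : Continuous (fun p : Set.Icc (0 : ℝ) (a i) × S =>
        fbar i (Function.update p.2.1 i p.1)) :=
      (hA.fbar_cont i).comp_continuous (c1.update i c0)
        (fun p => hupd p.2.1 p.2.2 i p.1 p.1.2)
    have c3 : Continuous (fun p : Set.Icc (0 : ℝ) (a i) × S => p.2.1 i) :=
      (continuous_apply i).comp c1
    exact (c0.sub (continuous_const.mul (c0.mul c2))).add ((c0.sub c3).pow 2)
  have hex : ∀ i s, ∃ t ∈ Set.Icc (lo i s) (hi i s),
      ∀ z ∈ Set.Icc (lo i s) (hi i s), Φ i s t ≤ Φ i s z := by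
    intro i s
    have c : ContinuousOn (Φ i s) (Set.Icc 0 (a i)) := by
      rw [continuousOn_iff_continuous_domRestrict]
      exact (hΦ i).comp (continuous_id.prodMk (continuous_const (y := s)))
    obtain ⟨t, ht, hm⟩ := (isCompact_Icc (a := lo i s) (b := hi i s)).exists_isMinOn
      (Set.nonempty_Icc.2 (hlh i s)) (c.mono (Set.Icc_subset_Icc (hlo0 i s) (hhia i s)))
    exact ⟨t, ht, fun z hz => hm hz⟩
  choose t ht htm using hex
  have htc : ∀ i, Continuous (t i) := fun i =>
    argmin_cont (a i) (Φ i) (lo i) (hi i) (t i) (hloc i) (hhic i) (hlo0 i) (hlh i) (hhia i) (hΦ i)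
      (ht i) (htm i) (fun s y hy hm =>
        prox_uniq (a i) (ψ i s) (hψ i s) (lo i s) (hi i s) (s.1 i) y (t i s) (hlo0 i s) (hhia i s)
          hy (ht i s) hm (htm i s))
  let T : (Fin n → ℝ) → (Fin n → ℝ) := fun s i => if hs : s ∈ S then t i ⟨s, hs⟩ else 0
  have hTs : ∀ s : S, ∀ i, T s.1 i = t i s := fun s i => dif_pos s.2
  obtain ⟨s, hs, hfix⟩ := brouwer_box n a ha T (by
      change ContinuousOn T S
      rw [continuousOn_iff_continuous_domRestrict]
      refine continuous_pi fun i => ?_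
      have : (fun s : S => S.domRestrict T s i) = t i := by
        funext s; exact hTs s i
      rw [this]; exact htc i) (by
      intro s hs i
      have e := hTs ⟨s, hs⟩ i
      simp only at e
      rw [e]
      exact ⟨(hlo0 _ _).trans (ht _ _).1, (ht _ _).2.trans (hhia _ _)⟩)
  refine ⟨s, hs, ?_⟩
  let s' : S := ⟨s, hs⟩
  have hsi : ∀ i, t i s' = s i := fun i => by rw [← hTs s' i]; exact congrFun hfix i
  intro i
  have hmem := ht i s'
  rw [hsi] at hmem
  refine ⟨fun hf => ?_, fun hf => ?_⟩
  · obtain ⟨h1, h2, h3⟩ := hlhfeas i s' hf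
    have hloe : lo i s' = max 0 ((h i - a i * q s') / (qb i s' - q s')) :=
      min_eq_right (max_le (ha i).le h1)
    have hhie : hi i s' = h i / qb i s' := min_eq_right h3
    rw [hloe, hhie] at hmem
    refine ⟨⟨hs i, hmem.2, (le_max_right _ _).trans hmem.1⟩, ?_⟩
    rintro x ⟨hx1, hx2, hx3⟩
    have hm := htm i s'
    rw [hsi] at hm
    have hopt := prox_fix (a i) (ψ i s') (hψ i s') (lo i s') (hi i s') (s i) (hlo0 _ _) (hhia _ _)
      (by rw [hloe, hhie]; exact hmem) hm x
      (by rw [hloe, hhie]; exact ⟨max_le hx1.1 hx3, hx2⟩)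
    simp only [ψ, s', Function.update_eq_self] at hopt
    simp only [obj, Function.update_self]
    linarith
  · have hloe : lo i s' = a i := by
      refine min_eq_left ((?_ : a i ≤ _).trans (le_max_right _ _))
      rw [le_div_iff₀ (hqqb i s')]
      have : a i * qb i s' < h i := hf
      linarith
    exact le_antisymm (hs i).2 (hloe ▸ hmem.1)
end
end

section
/- Under the LOB pricing structure, Assumption 2, and Assumptions 1(3)-1(4) on the haircut function g, there exist a greatest and a least clearing price vector: clearing price vectors (q↑, q̄↑) and (q↓, q̄↓) such that every clearing price vector (q,q̄) satisfies (q↓,q̄↓) ≤ (q,q̄) ≤ (q↑,q̄↑) componentwise. Furthermore, the set of clearing liquidation vectors {s̄(q,q̄) : (q,q̄) is a clearing price vector} possesses a greatest and a least element with respect to the componentwise order. -/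
noncomputable section

/-- Limit order book based price: all banks submit orders at the same rate, so when bank `i`
has sold `u` units the total volume sold is `∑ⱼ min(sⱼ, u)`.  The average price obtained by
bank `i` is `(1/sᵢ) ∫₀^{sᵢ} f(∑ⱼ min(sⱼ,u)) du`, which coincides with the order-statistics
formula of the LOB pricing scheme. -/
def lob (n : ℕ) (f : ℝ → ℝ) : Fin n → (Fin n → ℝ) → ℝ := fun i s =>
  if s i = 0 then 1 else (∫ u in (0:ℝ)..(s i), f (∑ j, min (s j) u)) / s i

/-- Assumption 2 on the order book density `f : [0,M] → (0,1]`. -/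
structure Assumption2 (M : ℝ) (f : ℝ → ℝ) : Prop where
  mem : ∀ x ∈ Set.Icc (0 : ℝ) M, f x ∈ Set.Ioc (0 : ℝ) 1
  anti : StrictAntiOn f (Set.Icc 0 M)
  smooth : ContDiffOn ℝ 2 f (Set.Icc 0 M)
  f_zero : f 0 = 1
  deriv_mono : MonotoneOn (derivWithin f (Set.Icc 0 M)) (Set.Icc 0 M)

/-- `(q, q̄)` is a clearing price vector under LOB pricing. -/
def ClearingLOB (n : ℕ) (a h : Fin n → ℝ) (r : ℝ) (f g : ℝ → ℝ)
    (q : ℝ) (qb : Fin n → ℝ) : Prop :=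
  ∃ s : Fin n → ℝ, memD n a s ∧ NashP2 n a h r q qb (lob n f) s ∧
    q = g (∑ i, s i) ∧ ∀ i, qb i = lob n f i s

/-- `s` is a clearing liquidation vector under LOB pricing: it is a Nash equilibrium of
(P2) at the prices it itself generates. -/
def ClearingLiqLOB (n : ℕ) (a h : Fin n → ℝ) (r : ℝ) (f g : ℝ → ℝ)
    (s : Fin n → ℝ) : Prop :=
  memD n a s ∧ NashP2 n a h r (g (∑ i, s i)) (fun i => lob n f i s) (lob n f) s

def VV (n : ℕ) (s : Fin n → ℝ) (u : ℝ) : ℝ := ∑ j, min (s j) u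

def RR (n : ℕ) (F : ℝ → ℝ) (s : Fin n → ℝ) (x : ℝ) : ℝ := ∫ u in (0:ℝ)..x, F (VV n s u)

structure Good (M : ℝ) (F : ℝ → ℝ) : Prop where
  cont : Continuous F
  anti : Antitone F
  pos : ∀ x, 0 < F x
  le1 : ∀ x, F x ≤ 1
  santi : StrictAntiOn F (Set.Icc 0 M)
  zero : F 0 = 1

theorem VV_mono (n : ℕ) (s : Fin n → ℝ) : Monotone (VV n s) := by
  intro u v huv
  exact Finset.sum_le_sum fun j _ => min_le_min_left _ huv

theorem VV_mono2 (n : ℕ) {s s' : Fin n → ℝ} (hs : ∀ i, s i ≤ s' i) (u : ℝ) :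
    VV n s u ≤ VV n s' u :=
  Finset.sum_le_sum fun j _ => min_le_min_right _ (hs j)

theorem VV_lt (n : ℕ) (s : Fin n → ℝ) (j : Fin n) {u v : ℝ} (huv : u < v) (hj : u < s j) :
    VV n s u < VV n s v := by
  refine Finset.sum_lt_sum (fun j _ => min_le_min_left _ huv.le) ⟨j, Finset.mem_univ _, ?_⟩
  rw [min_eq_right hj.le]
  exact lt_min hj huv

theorem VV_cont (n : ℕ) (s : Fin n → ℝ) : Continuous (VV n s) := by
  unfold VV; fun_prop

theorem VV_mem {n : ℕ} {a s : Fin n → ℝ} {M : ℝ} (hM : ∑ i, a i ≤ M) (hs : memD n a s)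
    {u : ℝ} (hu : 0 ≤ u) : VV n s u ∈ Set.Icc 0 M := by
  refine ⟨Finset.sum_nonneg fun j _ => le_min (hs j).1 hu, le_trans ?_ hM⟩
  exact Finset.sum_le_sum fun j _ => (min_le_left _ _).trans (hs j).2

theorem RR_int {n : ℕ} {M : ℝ} {F : ℝ → ℝ} (hF : Good M F) (s : Fin n → ℝ) (x y : ℝ) :
    IntervalIntegrable (fun u => F (VV n s u)) MeasureTheory.volume x y :=
  (hF.cont.comp (VV_cont n s)).intervalIntegrable _ _

theorem RR_sub {n : ℕ} {M : ℝ} {F : ℝ → ℝ} (hF : Good M F) (s : Fin n → ℝ) (x y : ℝ) :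
    RR n F s y - RR n F s x = ∫ u in x..y, F (VV n s u) :=
  intervalIntegral.integral_interval_sub_left (RR_int hF s _ _) (RR_int hF s _ _)

theorem RR_upper {n : ℕ} {M : ℝ} {F : ℝ → ℝ} (hF : Good M F) (s : Fin n → ℝ) {x y : ℝ}
    (hxy : x ≤ y) : RR n F s y - RR n F s x ≤ (y - x) * F (VV n s x) := by
  rw [RR_sub hF]
  have := intervalIntegral.integral_mono_on (μ := MeasureTheory.volume) hxy (RR_int hF s x y)
    (intervalIntegrable_const (c := F (VV n s x)))
    (fun u hu => hF.anti (VV_mono n s hu.1))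
  simpa using this

theorem RR_lower {n : ℕ} {M : ℝ} {F : ℝ → ℝ} (hF : Good M F) (s : Fin n → ℝ) {x y : ℝ}
    (hxy : x ≤ y) : (y - x) * F (VV n s y) ≤ RR n F s y - RR n F s x := by
  rw [RR_sub hF]
  have := intervalIntegral.integral_mono_on (μ := MeasureTheory.volume) hxy
    (intervalIntegrable_const (c := F (VV n s y))) (RR_int hF s x y)
    (fun u hu => hF.anti (VV_mono n s hu.2))
  simpa using this

theorem RR_strict {n : ℕ} {M : ℝ} {F : ℝ → ℝ} (hF : Good M F) (s : Fin n → ℝ) :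
    StrictMono (RR n F s) := by
  intro x y hxy
  have := RR_lower hF s hxy.le
  have h2 := mul_pos (sub_pos.2 hxy) (hF.pos (VV n s y))
  linarith

theorem RR_zero (n : ℕ) (F : ℝ → ℝ) (s : Fin n → ℝ) : RR n F s 0 = 0 := by
  simp [RR]

theorem RR_congr {n : ℕ} {F : ℝ → ℝ} {s s' : Fin n → ℝ} {x : ℝ} (hx : 0 ≤ x)
    (h : ∀ u, u ≤ x → VV n s u = VV n s' u) : RR n F s x = RR n F s' x := by
  unfold RR
  apply intervalIntegral.integral_congr
  intro u hu
  rw [Set.uIcc_of_le hx] at hu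
  simp only [h u hu.2]

theorem RR_mono2 {n : ℕ} {M : ℝ} {F : ℝ → ℝ} (hF : Good M F) {s s' : Fin n → ℝ}
    (hs : ∀ i, s i ≤ s' i) {x : ℝ} (hx : 0 ≤ x) : RR n F s' x ≤ RR n F s x := by
  unfold RR
  exact intervalIntegral.integral_mono_on hx (RR_int hF s' 0 x) (RR_int hF s 0 x)
    (fun u _ => hF.anti (VV_mono2 n hs u))

theorem RR_cont {n : ℕ} {M : ℝ} {F : ℝ → ℝ} (hF : Good M F) (i : Fin n) :
    Continuous (fun b : Fin n → ℝ => RR n F b (b i)) := by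
  unfold RR
  apply intervalIntegral.continuous_parametric_intervalIntegral_of_continuous
  · have := hF.cont
    unfold VV
    simp only [Function.uncurry_def]
    fun_prop
  · fun_prop

def tight (n : ℕ) (F : ℝ → ℝ) (r : ℝ) (a h b : Fin n → ℝ) (i : Fin n) : Prop :=
  b i = a i ∨ (1 + r) * F (VV n b (b i)) = 1 ∨ RR n F b (b i) = h i

def pre (n : ℕ) (F : ℝ → ℝ) (r : ℝ) (a h b : Fin n → ℝ) (i : Fin n) : Prop :=
  b i ∈ Set.Icc 0 (a i) ∧ 1 ≤ (1 + r) * F (VV n b (b i)) ∧ RR n F b (b i) ≤ h i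

theorem cont_c {n : ℕ} {M : ℝ} {F : ℝ → ℝ} (hF : Good M F) (r : ℝ) (i : Fin n) :
    Continuous (fun b : Fin n → ℝ => (1 + r) * F (VV n b (b i))) := by
  have := hF.cont
  unfold VV
  fun_prop

theorem exists_b {n : ℕ} {M : ℝ} {F : ℝ → ℝ} (hF : Good M F) {r : ℝ} {a h : Fin n → ℝ}
    (ha : ∀ i, 0 < a i) (hh : ∀ i, 0 < h i) (hr : 0 ≤ r) :
    ∃ b : Fin n → ℝ, ∀ i, pre n F r a h b i ∧ tight n F r a h b i := by
  classical
  let K : Set (Fin n → ℝ) := {b | (∀ i, pre n F r a h b i) ∧ ∀ i j, b j ≤ b i ∨ tight n F r a h b i}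
  have hclosed : IsClosed K := by
    have h1 : ∀ i, IsClosed {b : Fin n → ℝ | pre n F r a h b i} := by
      intro i
      refine IsClosed.and (IsClosed.and ?_ ?_) (IsClosed.and ?_ ?_)
      · exact isClosed_le continuous_const (continuous_apply i)
      · exact isClosed_le (continuous_apply i) continuous_const
      · exact isClosed_le continuous_const (cont_c hF r i)
      · exact isClosed_le (RR_cont hF i) continuous_const
    have h2 : ∀ i j, IsClosed {b : Fin n → ℝ | b j ≤ b i ∨ tight n F r a h b i} := by
      intro i j
      refine IsClosed.union ?_ (IsClosed.union ?_ (IsClosed.union ?_ ?_))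
      · exact isClosed_le (continuous_apply j) (continuous_apply i)
      · exact isClosed_eq (continuous_apply i) continuous_const
      · exact isClosed_eq (cont_c hF r i) continuous_const
      · exact isClosed_eq (RR_cont hF i) continuous_const
    have : K = (⋂ i, {b : Fin n → ℝ | pre n F r a h b i}) ∩
        ⋂ i, ⋂ j, {b : Fin n → ℝ | b j ≤ b i ∨ tight n F r a h b i} := by
      ext b; simp [K]
    rw [this]
    exact (isClosed_iInter h1).inter (isClosed_iInter fun i => isClosed_iInter fun j => h2 i j)
  have hcomp : IsCompact K := by
    refine (isCompact_Icc (a := (0 : Fin n → ℝ)) (b := a)).of_isClosed_subset hclosed ?_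
    intro b hb
    exact ⟨fun i => (hb.1 i).1.1, fun i => (hb.1 i).1.2⟩
  have hne : K.Nonempty := by
    refine ⟨0, fun i => ⟨⟨le_rfl, (ha i).le⟩, ?_, ?_⟩, fun i j => Or.inl le_rfl⟩
    · simp [VV, hF.zero, hr]
    · simp [RR_zero, (hh i).le]
  obtain ⟨b, hbK, hbmax⟩ := hcomp.exists_isMaxOn hne
    (f := fun b : Fin n → ℝ => ∑ i, b i) (by fun_prop)
  refine ⟨b, fun i => ⟨hbK.1 i, ?_⟩⟩
  by_contra hi
  have hmaxnt : ∀ k, ¬ tight n F r a h b k → ∀ j, b j ≤ b k := fun k hk j =>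
    (hbK.2 k j).resolve_right hk
  let be : ℝ → Fin n → ℝ := fun e j => if tight n F r a h b j then b j else b j + e
  have hbe0 : be 0 = b := by ext j; simp [be]
  have hbec : Continuous be := by
    refine continuous_pi fun j => ?_
    by_cases hj : tight n F r a h b j
    · simp only [be, hj, if_true]; fun_prop
    · simp only [be, hj, if_false]; fun_prop
  have hev : ∀ j, ∀ᶠ e in nhds (0:ℝ), ¬ tight n F r a h b j →
      be e j < a j ∧ 1 < (1 + r) * F (VV n (be e) (be e j)) ∧ RR n F (be e) (be e j) < h j := by
    intro j
    by_cases hj : tight n F r a h b j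
    · simp [hj]
    have hj2 := hj
    unfold tight at hj2
    push Not at hj2
    obtain ⟨hp1, hp2, hp3⟩ := hbK.1 j
    have e1 : ∀ᶠ e in nhds (0:ℝ), be e j < a j := by
      refine ((continuous_apply j).comp hbec).continuousAt.eventually_lt continuousAt_const ?_
      simp only [Function.comp, hbe0]
      exact lt_of_le_of_ne hp1.2 hj2.1
    have e2 : ∀ᶠ e in nhds (0:ℝ), 1 < (1 + r) * F (VV n (be e) (be e j)) := by
      refine continuousAt_const.eventually_lt (((cont_c hF r j).comp hbec).continuousAt) ?_
      simp only [Function.comp, hbe0]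
      exact lt_of_le_of_ne hp2 (Ne.symm hj2.2.1)
    have e3 : ∀ᶠ e in nhds (0:ℝ), RR n F (be e) (be e j) < h j := by
      refine (((RR_cont hF j).comp hbec).continuousAt).eventually_lt continuousAt_const ?_
      simp only [Function.comp, hbe0]
      exact lt_of_le_of_ne hp3 hj2.2.2
    filter_upwards [e1, e2, e3] with e h1 h2 h3 _
    exact ⟨h1, h2, h3⟩
  have hev2 := (Filter.eventually_all.2 hev)
  obtain ⟨e, he, hepos⟩ := ((hev2.filter_mono (nhdsWithin_le_nhds (s := Set.Ioi 0))).and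
    self_mem_nhdsWithin).exists
  have hepos : 0 < e := hepos
  have hV : ∀ j u, u ≤ b j → VV n (be e) u = VV n b u := by
    intro j u hu
    refine Finset.sum_congr rfl fun k _ => ?_
    by_cases hk : tight n F r a h b k
    · simp [be, hk]
    · have := hmaxnt k hk j
      simp only [be, hk, if_false]
      rw [min_eq_right (by linarith), min_eq_right (by linarith)]
  have hbj : ∀ j, tight n F r a h b j → be e j = b j := fun j hj => by simp [be, hj]
  have htt : ∀ j, tight n F r a h b j → tight n F r a h (be e) j := by
    intro j hj
    have h0 := (hbK.1 j).1.1
    unfold tight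
    rw [hbj j hj, hV j _ le_rfl, RR_congr h0 (hV j)]
    exact hj
  have hin : be e ∈ K := by
    refine ⟨fun j => ?_, fun j k => ?_⟩
    · by_cases hj : tight n F r a h b j
      · have h0 := (hbK.1 j).1.1
        unfold pre
        rw [hbj j hj, hV j _ le_rfl, RR_congr h0 (hV j)]
        exact hbK.1 j
      · obtain ⟨h1, h2, h3⟩ := he j hj
        refine ⟨⟨?_, h1.le⟩, h2.le, h3.le⟩
        have := (hbK.1 j).1.1
        simp only [be, hj, if_false]; linarith
    · by_cases hj : tight n F r a h b j
      · exact Or.inr (htt j hj)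
      · left
        have := hmaxnt j hj k
        by_cases hk : tight n F r a h b k
        · simp only [be, hj, hk, if_false, if_true]; linarith
        · simp only [be, hj, hk, if_false]; linarith
  have hlt : ∑ j, b j < ∑ j, be e j := by
    refine Finset.sum_lt_sum (fun j _ => ?_) ⟨i, Finset.mem_univ _, ?_⟩
    · by_cases hj : tight n F r a h b j
      · simp [be, hj]
      · simp only [be, hj, if_false]; linarith
    · simp only [be, hi, if_false]; linarith
  exact absurd (hbmax hin) (not_le.2 hlt)

/-- lower bound -/
def ell (a h p q : ℝ) : ℝ := if a * p < h then a else max 0 ((h - a * q) / (p - q))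

theorem ell_le_iff {a h p q y : ℝ} (hq : q < p) (hp : h ≤ a * p) (hy : 0 ≤ y) :
    ell a h p q ≤ y ↔ h ≤ y * p + (a - y) * q := by
  unfold ell
  rw [if_neg (not_lt.2 hp), max_le_iff, div_le_iff₀ (sub_pos.2 hq)]
  constructor
  · rintro ⟨_, h2⟩; linarith
  · intro h2; exact ⟨hy, by linarith⟩

theorem ell_mem {a h p q : ℝ} (ha : 0 < a) (hq : q < p) : ell a h p q ∈ Set.Icc 0 a := by
  by_cases hp : a * p < h
  · simp [ell, hp, ha.le]
  · push Not at hp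
    refine ⟨?_, (ell_le_iff hq hp ha.le).2 (by linarith)⟩
    unfold ell; rw [if_neg (not_lt.2 hp)]; exact le_max_left _ _

theorem ell_mono {a h p q p' q' : ℝ} (ha : 0 < a) (hq : q < p) (hq' : q' < p')
    (hpp : p' ≤ p) (hqq : q' ≤ q) : ell a h p q ≤ ell a h p' q' := by
  have m := ell_mem (h := h) ha hq
  have m' := ell_mem (h := h) ha hq'
  by_cases hp' : a * p' < h
  · have : ell a h p' q' = a := by simp [ell, hp']
    rw [this]; exact m.2
  · push Not at hp'
    have hp : h ≤ a * p := hp'.trans (by gcongr)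
    have h1 := (ell_le_iff hq' hp' m'.1).1 le_rfl
    refine (ell_le_iff hq hp m'.1).2 (h1.trans ?_)
    have := mul_le_mul_of_nonneg_left hpp m'.1
    have := mul_le_mul_of_nonneg_left hqq (sub_nonneg.2 m'.2)
    linarith

theorem ell_rev {a h p q : ℝ} (ha : 0 < a) (hq0 : 0 < q) (hq : q < p) (hh : 0 < h) :
    ell a h p q * p ≤ h := by
  by_cases hp : a * p < h
  · simp [ell, hp, hp.le]
  · have hp2 := hp
    push Not at hp2
    have m := ell_mem (h := h) ha hq
    unfold ell at m ⊢
    rw [if_neg hp] at m ⊢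
    rcases le_total ((h - a * q) / (p - q)) 0 with h0 | h0
    · rw [max_eq_left h0]; simp [hh.le]
    · rw [max_eq_right h0] at m ⊢
      have hne : p - q ≠ 0 := (sub_pos.2 hq).ne'
      have e : (h - a * q) / (p - q) * (p - q) = h - a * q := div_mul_cancel₀ _ hne
      have := mul_nonneg (sub_nonneg.2 m.2) hq0.le
      nlinarith

theorem tarski {n : ℕ} {lo hi : Fin n → ℝ} (hle : lo ≤ hi)
    (T : (Fin n → ℝ) → (Fin n → ℝ))
    (hmaps : ∀ s ∈ Set.Icc lo hi, T s ∈ Set.Icc lo hi)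
    (hmono : ∀ s ∈ Set.Icc lo hi, ∀ s' ∈ Set.Icc lo hi, s ≤ s' → T s ≤ T s') :
    ∃ x y, (x ∈ Set.Icc lo hi ∧ T x = x) ∧ (y ∈ Set.Icc lo hi ∧ T y = y) ∧
      ∀ s ∈ Set.Icc lo hi, T s = s → x ≤ s ∧ s ≤ y := by
  let _ : Fact (lo ≤ hi) := ⟨hle⟩
  let _ : CompleteLattice (Set.Icc lo hi) := Set.Icc.completeLattice
  let G : Set.Icc lo hi →o Set.Icc lo hi :=
    ⟨fun s => ⟨T s.1, hmaps s.1 s.2⟩, fun s s' hs => hmono s.1 s.2 s'.1 s'.2 hs⟩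
  refine ⟨(OrderHom.lfp G).1, (OrderHom.gfp G).1, ⟨(OrderHom.lfp G).2, ?_⟩,
    ⟨(OrderHom.gfp G).2, ?_⟩, fun s hs hT => ⟨?_, ?_⟩⟩
  · exact congrArg Subtype.val (OrderHom.map_lfp G)
  · exact congrArg Subtype.val (OrderHom.map_gfp G)
  · exact OrderHom.lfp_le G (a := ⟨s, hs⟩) (le_of_eq (Subtype.ext hT))
  · exact OrderHom.le_gfp G (a := ⟨s, hs⟩) (le_of_eq (Subtype.ext hT.symm))

theorem VV_upd {n : ℕ} {a s : Fin n → ℝ} {i : Fin n} {x u : ℝ} (hu : u ≤ x) (hx : x ≤ a i) :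
    VV n (Function.update s i x) u = VV n (Function.update s i (a i)) u := by
  refine Finset.sum_congr rfl fun k _ => ?_
  by_cases hk : k = i
  · subst hk
    simp only [Function.update_self]
    rw [min_eq_right hu, min_eq_right (hu.trans hx)]
  · simp [Function.update_of_ne hk]

theorem memD_upd {n : ℕ} {a s : Fin n → ℝ} (hs : memD n a s) {i : Fin n} {x : ℝ}
    (hx : x ∈ Set.Icc 0 (a i)) : memD n a (Function.update s i x) := by
  intro k
  by_cases hk : k = i
  · subst hk; simpa using hx
  · simpa [Function.update_of_ne hk] using hs k

theorem obj_upd {n : ℕ} {F : ℝ → ℝ} {r : ℝ} {a h : Fin n → ℝ}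
    {L : Fin n → (Fin n → ℝ) → ℝ}
    (hL : ∀ s, memD n a s → ∀ i, s i * L i s = RR n F s (s i))
    {s : Fin n → ℝ} (hs : memD n a s) {i : Fin n} {x : ℝ} (hx : x ∈ Set.Icc 0 (a i)) :
    obj n r h L i (Function.update s i x) =
      x + r * h i - (1 + r) * RR n F (Function.update s i (a i)) x := by
  have h1 := hL _ (memD_upd hs hx) i
  simp only [Function.update_self] at h1
  rw [RR_congr hx.1 (fun u hu => VV_upd (a := a) hu hx.2)] at h1
  unfold obj
  simp only [Function.update_self]
  rw [← h1]; ring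

theorem obj_self {n : ℕ} {F : ℝ → ℝ} {r : ℝ} {a h : Fin n → ℝ}
    {L : Fin n → (Fin n → ℝ) → ℝ}
    (hL : ∀ s, memD n a s → ∀ i, s i * L i s = RR n F s (s i))
    {s : Fin n → ℝ} (hs : memD n a s) (i : Fin n) :
    obj n r h L i s =
      s i + r * h i - (1 + r) * RR n F (Function.update s i (a i)) (s i) := by
  have := obj_upd (r := r) (h := h) hL hs (hs i)
  rwa [Function.update_eq_self] at this

theorem VV_self {n : ℕ} {a s : Fin n → ℝ} (hs : memD n a s) (i : Fin n) :
    VV n (Function.update s i (a i)) (s i) = VV n s (s i) := by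
  have := VV_upd (s := s) (le_refl (s i)) (hs i).2
  rw [Function.update_eq_self] at this
  exact this.symm

theorem opt_suff {n : ℕ} {M : ℝ} {F : ℝ → ℝ} (hF : Good M F) {r : ℝ} (hr : 0 ≤ r)
    {a h : Fin n → ℝ} {L : Fin n → (Fin n → ℝ) → ℝ}
    (hL : ∀ s, memD n a s → ∀ i, s i * L i s = RR n F s (s i))
    {s : Fin n → ℝ} (hs : memD n a s) {i : Fin n} {x : ℝ} (hx : x ∈ Set.Icc 0 (a i))
    (h1 : s i ≤ x ∨ 1 ≤ (1 + r) * F (VV n s (s i)))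
    (h2 : x ≤ s i ∨ (1 + r) * F (VV n s (s i)) ≤ 1) :
    obj n r h L i s ≤ obj n r h L i (Function.update s i x) := by
  rw [obj_upd hL hs hx, obj_self hL hs, ← VV_self hs] at *
  have hr1 : 0 ≤ 1 + r := by linarith
  rcases le_total x (s i) with hxs | hxs
  · have h3 := mul_le_mul_of_nonneg_left (RR_lower hF (Function.update s i (a i)) hxs) hr1
    rcases h1 with h1 | h1
    · have : x = s i := le_antisymm hxs h1
      rw [this]
    · have := mul_le_mul_of_nonneg_left h1 (sub_nonneg.2 hxs)
      nlinarith
  · have h3 := mul_le_mul_of_nonneg_left (RR_upper hF (Function.update s i (a i)) hxs) hr1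
    rcases h2 with h2 | h2
    · have : x = s i := le_antisymm h2 hxs
      rw [this]
    · have := mul_le_mul_of_nonneg_left h2 (sub_nonneg.2 hxs)
      nlinarith

theorem opt_nec1 {n : ℕ} {M : ℝ} {F : ℝ → ℝ} (hF : Good M F) {r : ℝ} (hr : 0 ≤ r)
    {a h : Fin n → ℝ} {L : Fin n → (Fin n → ℝ) → ℝ}
    (hL : ∀ s, memD n a s → ∀ i, s i * L i s = RR n F s (s i))
    {s : Fin n → ℝ} (hs : memD n a s) {i : Fin n} {l : ℝ} (hl : 0 ≤ l) (hls : l < s i)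
    (hopt : ∀ x ∈ Set.Icc l (s i), obj n r h L i s ≤ obj n r h L i (Function.update s i x)) :
    1 ≤ (1 + r) * F (VV n s (s i)) := by
  by_contra hc
  push Not at hc
  rw [← VV_self hs] at hc
  have hr1 : 0 ≤ 1 + r := by linarith
  have hcont : Continuous fun u => (1 + r) * F (VV n (Function.update s i (a i)) u) :=
    continuous_const.mul (hF.cont.comp (VV_cont n _))
  have hev : ∀ᶠ u in nhds (s i), (1 + r) * F (VV n (Function.update s i (a i)) u) < 1 :=
    hcont.continuousAt.eventually_lt continuousAt_const hc
  obtain ⟨y, hy, hy2⟩ := ((hev.filter_mono (nhdsWithin_le_nhds (s := Set.Iio (s i)))).and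
    (Ioo_mem_nhdsLT hls)).exists
  have h1 := hopt y ⟨hy2.1.le, hy2.2.le⟩
  rw [obj_upd hL hs ⟨hl.trans hy2.1.le, hy2.2.le.trans (hs i).2⟩, obj_self hL hs] at h1
  have h3 := mul_le_mul_of_nonneg_left (RR_upper hF (Function.update s i (a i)) hy2.2.le) hr1
  have := mul_lt_mul_of_pos_left hy (sub_pos.2 hy2.2)
  nlinarith

theorem opt_nec2 {n : ℕ} {M : ℝ} {F : ℝ → ℝ} (hF : Good M F) {r : ℝ} (hr : 0 ≤ r)
    {a h : Fin n → ℝ} {L : Fin n → (Fin n → ℝ) → ℝ}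
    (hL : ∀ s, memD n a s → ∀ i, s i * L i s = RR n F s (s i))
    {s : Fin n → ℝ} (hs : memD n a s) {i : Fin n} {l : ℝ} (hl : l ≤ a i) (hls : s i < l)
    (hopt : ∀ x ∈ Set.Icc (s i) l, obj n r h L i s ≤ obj n r h L i (Function.update s i x)) :
    (1 + r) * F (VV n s (s i)) ≤ 1 := by
  by_contra hc
  push Not at hc
  rw [← VV_self hs] at hc
  have hr1 : 0 ≤ 1 + r := by linarith
  have hcont : Continuous fun u => (1 + r) * F (VV n (Function.update s i (a i)) u) :=
    continuous_const.mul (hF.cont.comp (VV_cont n _))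
  have hev : ∀ᶠ u in nhds (s i), 1 < (1 + r) * F (VV n (Function.update s i (a i)) u) :=
    continuousAt_const.eventually_lt hcont.continuousAt hc
  obtain ⟨y, hy, hy2⟩ := ((hev.filter_mono (nhdsWithin_le_nhds (s := Set.Ioi (s i)))).and
    (Ioo_mem_nhdsGT hls)).exists
  have h1 := hopt y ⟨hy2.1.le, hy2.2.le⟩
  rw [obj_upd hL hs ⟨(hs i).1.trans hy2.1.le, hy2.2.le.trans hl⟩, obj_self hL hs] at h1
  have h3 := mul_le_mul_of_nonneg_left (RR_lower hF (Function.update s i (a i)) hy2.1.le) hr1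
  have := mul_lt_mul_of_pos_left hy (sub_pos.2 hy2.1)
  nlinarith

/-- marginal gain strictly decreasing -/
theorem marg_lt {n : ℕ} {M : ℝ} {F : ℝ → ℝ} (hF : Good M F) {r : ℝ} (hr : 0 ≤ r)
    {a s : Fin n → ℝ} (hM : ∑ i, a i ≤ M) (hs : memD n a s) (j : Fin n) {u v : ℝ}
    (hu : 0 ≤ u) (huv : u < v) (hj : u < s j) :
    (1 + r) * F (VV n s v) < (1 + r) * F (VV n s u) := by
  have := hF.santi (VV_mem hM hs hu) (VV_mem hM hs (hu.trans huv.le)) (VV_lt n s j huv hj)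
  have hr1 : 0 < 1 + r := by linarith
  exact mul_lt_mul_of_pos_left this hr1

/-- if the marginal constraint binds at `j`, then `b j` is maximal -/
theorem max_of_marg {n : ℕ} {M : ℝ} {F : ℝ → ℝ} (hF : Good M F) {r : ℝ} (hr : 0 ≤ r)
    {a h b : Fin n → ℝ} (hM : ∑ i, a i ≤ M)
    (hb : ∀ i, pre n F r a h b i ∧ tight n F r a h b i) {j : Fin n}
    (hj : (1 + r) * F (VV n b (b j)) = 1) (k : Fin n) : b k ≤ b j := by
  by_contra hc
  push Not at hc
  have := marg_lt hF hr hM (fun i => (hb i).1.1) k (hb j).1.1.1 hc hc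
  have := (hb k).1.2.1
  linarith

theorem lemA {n : ℕ} {M : ℝ} {F : ℝ → ℝ} (hF : Good M F) {r : ℝ} (hr : 0 ≤ r)
    {a h b s : Fin n → ℝ} (hM : ∑ i, a i ≤ M)
    (hb : ∀ i, pre n F r a h b i ∧ tight n F r a h b i)
    (hs : memD n a s) (hbs : ∀ i, b i ≤ s i)
    (hR : ∀ i, b i < s i → RR n F s (s i) ≤ h i) :
    (∀ i u, u ≤ b i → VV n s u = VV n b u) ∧
    ∀ i, b i < s i → (1 + r) * F (VV n s (b i)) = 1 := by
  classical
  by_cases hne : (Finset.univ.filter fun i => b i < s i).Nonempty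
  · obtain ⟨j, hj, hjmin⟩ := Finset.exists_min_image _ b hne
    simp only [Finset.mem_filter, Finset.mem_univ, true_and] at hj hjmin
    have hV : ∀ u, u ≤ b j → VV n s u = VV n b u := by
      intro u hu
      refine Finset.sum_congr rfl fun k _ => ?_
      rcases (hbs k).eq_or_lt with hk | hk
      · rw [hk]
      · have := hjmin k hk
        rw [min_eq_right (by linarith), min_eq_right (by linarith)]
    have hmj : (1 + r) * F (VV n b (b j)) = 1 := by
      rcases (hb j).2 with h1 | h1 | h1
      · have := (hs j).2; linarith
      · exact h1
      · have h2 := RR_strict hF s hj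
        rw [RR_congr (hb j).1.1.1 hV, h1] at h2
        have := hR j hj
        linarith
    have hmax := max_of_marg hF hr hM hb hmj
    refine ⟨fun i u hu => hV u (hu.trans (hmax i)), fun i hi => ?_⟩
    have : b i = b j := le_antisymm (hmax i) (hjmin i hi)
    rw [this, hV _ le_rfl, hmj]
  · rw [Finset.not_nonempty_iff_eq_empty, Finset.filter_eq_empty_iff] at hne
    have hsb : s = b := by
      ext i
      exact le_antisymm (not_lt.1 (hne (Finset.mem_univ i))) (hbs i)
    refine ⟨fun i u _ => by rw [hsb], fun i hi => absurd hi (hne (Finset.mem_univ i))⟩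

theorem clearing_of_fix {n : ℕ} {M : ℝ} {F : ℝ → ℝ} (hF : Good M F) {r : ℝ} (hr : 0 ≤ r)
    {a h b s : Fin n → ℝ} (hM : ∑ i, a i ≤ M) (ha : ∀ i, 0 < a i) (hh : ∀ i, 0 < h i)
    (hb : ∀ i, pre n F r a h b i ∧ tight n F r a h b i)
    {L : Fin n → (Fin n → ℝ) → ℝ}
    (hL : ∀ s, memD n a s → ∀ i, s i * L i s = RR n F s (s i))
    (hs : memD n a s) {q : ℝ} (hq0 : 0 < q) (hq : ∀ i, q < L i s)
    (hfix : ∀ i, s i = max (b i) (ell (a i) (h i) (L i s) q)) :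
    NashP2 n a h r q (fun i => L i s) L s := by
  have hbs : ∀ i, b i ≤ s i := fun i => by rw [hfix i]; exact le_max_left _ _
  have hes : ∀ i, ell (a i) (h i) (L i s) q ≤ s i := fun i => by
    conv_rhs => rw [hfix i]
    exact le_max_right _ _
  have heq : ∀ i, b i < s i → s i = ell (a i) (h i) (L i s) q := by
    intro i hi
    rcases max_choice (b i) (ell (a i) (h i) (L i s) q) with h1 | h1
    · have := hfix i; rw [h1] at this; linarith
    · have := hfix i; rwa [h1] at this
  have hR : ∀ i, b i < s i → RR n F s (s i) ≤ h i := by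
    intro i hi
    rw [← hL s hs i]
    have := ell_rev (ha i) hq0 (hq i) (hh i)
    rwa [← heq i hi] at this
  obtain ⟨hV, hm⟩ := lemA hF hr hM hb hs hbs hR
  have hRb : ∀ i, RR n F s (b i) = RR n F b (b i) := fun i => RR_congr (hb i).1.1.1 (hV i)
  have hRall : ∀ i, RR n F s (s i) ≤ h i := by
    intro i
    rcases (hbs i).eq_or_lt with hi | hi
    · rw [← hi, hRb]; exact (hb i).1.2.2
    · exact hR i hi
  intro i
  have hp0 : 0 < L i s := hq0.trans (hq i)
  refine ⟨fun hi => ⟨⟨hs i, ?_, ?_⟩, ?_⟩, fun hi => ?_⟩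
  · rw [le_div_iff₀ hp0, hL s hs]; exact hRall i
  · have := hes i
    unfold ell at this
    rw [if_neg (not_lt.2 hi)] at this
    exact (le_max_right _ _).trans this
  · rintro x ⟨hx1, hx2, hx3⟩
    rcases (hbs i).eq_or_lt with hbi | hbi
    · refine opt_suff hF hr hL hs hx1 (Or.inr ?_) ?_
      · rw [← hbi, hV i _ le_rfl]; exact (hb i).1.2.1
      · rcases (hb i).2 with h1 | h1 | h1
        · left; rw [← hbi, h1]; exact hx1.2
        · right; rw [← hbi, hV i _ le_rfl, h1]
        · left
          rw [le_div_iff₀ hp0, ← h1, ← hRb, hbi, ← hL s hs] at hx2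
          exact le_of_mul_le_mul_right hx2 hp0
    · refine opt_suff hF hr hL hs hx1 (Or.inl ?_) (Or.inr ?_)
      · rw [heq i hbi]
        unfold ell
        rw [if_neg (not_lt.2 hi)]
        exact max_le hx1.1 hx3
      · have := marg_lt hF hr hM hs i (hb i).1.1.1 hbi hbi
        rw [hm i hbi] at this
        exact this.le
  · have := hes i
    simp only [ell, hi, if_true] at this
    exact le_antisymm (hs i).2 this

theorem fix_of_clearing {n : ℕ} {M : ℝ} {F : ℝ → ℝ} (hF : Good M F) {r : ℝ} (hr : 0 ≤ r)
    {a h b s : Fin n → ℝ} (hM : ∑ i, a i ≤ M)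
    (hb : ∀ i, pre n F r a h b i ∧ tight n F r a h b i)
    {L : Fin n → (Fin n → ℝ) → ℝ}
    (hL : ∀ s, memD n a s → ∀ i, s i * L i s = RR n F s (s i))
    (hs : memD n a s) {q : ℝ} (hq0 : 0 < q) (hq : ∀ i, q < L i s)
    (hN : NashP2 n a h r q (fun i => L i s) L s) :
    ∀ i, s i = max (b i) (ell (a i) (h i) (L i s) q) := by
  classical
  have hp0 : ∀ i, 0 < L i s := fun i => hq0.trans (hq i)
  have hR : ∀ i, RR n F s (s i) ≤ h i := by
    intro i
    rw [← hL s hs i]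
    rcases le_or_gt (h i) (a i * L i s) with hi | hi
    · have := ((hN i).1 hi).1.2.1
      rwa [le_div_iff₀ (hp0 i)] at this
    · rw [(hN i).2 hi]; exact hi.le
  have hes : ∀ i, ell (a i) (h i) (L i s) q ≤ s i := by
    intro i
    rcases le_or_gt (h i) (a i * L i s) with hi | hi
    · have := ((hN i).1 hi).1.2.2
      unfold ell
      rw [if_neg (not_lt.2 hi)]
      exact max_le (hs i).1 this
    · simp only [ell, hi, if_true]; exact ((hN i).2 hi).ge
  have hbs : ∀ i, b i ≤ s i := by
    by_contra hcon
    push Not at hcon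
    obtain ⟨i0, hi0⟩ := hcon
    have hne : (Finset.univ.filter fun i => s i ≠ b i).Nonempty :=
      ⟨i0, by simp [hi0.ne]⟩
    obtain ⟨j, hj, hjmin⟩ := Finset.exists_min_image _ (fun i => min (s i) (b i)) hne
    simp only [Finset.mem_filter, Finset.mem_univ, true_and] at hj hjmin
    have hV : ∀ u, u ≤ min (s j) (b j) → VV n s u = VV n b u := by
      intro u hu
      refine Finset.sum_congr rfl fun k _ => ?_
      by_cases hk : s k = b k
      · rw [hk]
      · have := le_min_iff.1 (hu.trans (hjmin k hk))
        rw [min_eq_right this.1, min_eq_right this.2]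
    rcases lt_or_gt_of_ne hj with hlt | hlt
    · rw [min_eq_left hlt.le] at hV
      have hsa : s j < a j := hlt.trans_le (hb j).1.1.2
      have hi : h j ≤ a j * L j s := by
        by_contra hc
        push Not at hc
        have := (hN j).2 hc
        linarith
      have hRlt : RR n F s (s j) < h j := by
        rw [RR_congr (hs j).1 hV]
        exact (RR_strict hF b hlt).trans_le (hb j).1.2.2
      rw [← hL s hs j, ← lt_div_iff₀ (hp0 j)] at hRlt
      have h1 := opt_nec2 hF hr (h := h) (l := min (a j) (h j / L j s)) hL hs
        (min_le_left _ _) (lt_min hsa hRlt) (fun x hx => ((hN j).1 hi).2 x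
          ⟨⟨(hs j).1.trans hx.1, hx.2.trans (min_le_left _ _)⟩, hx.2.trans (min_le_right _ _),
            ((hN j).1 hi).1.2.2.trans hx.1⟩)
      rw [hV _ le_rfl] at h1
      have h2 := marg_lt hF hr hM (fun i => (hb i).1.1) j (hs j).1 hlt hlt
      have h3 := (hb j).1.2.1
      linarith
    · rw [min_eq_right hlt.le] at hV
      rcases (hb j).2 with h1 | h1 | h1
      · have := (hs j).2; linarith
      · have h2 := max_of_marg hF hr hM hb h1 i0
        have h3 := hjmin i0 hi0.ne
        rw [min_eq_right hlt.le, min_eq_left hi0.le] at h3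
        linarith
      · have h2 := RR_strict hF s hlt
        rw [RR_congr (hb j).1.1.1 hV, h1] at h2
        have := hR j
        linarith
  obtain ⟨hV, hm⟩ := lemA hF hr hM hb hs hbs (fun i _ => hR i)
  intro i
  refine le_antisymm ?_ (max_le (hbs i) (hes i))
  by_contra hc
  push Not at hc
  obtain ⟨hbi, hei⟩ := max_lt_iff.1 hc
  have hi : h i ≤ a i * L i s := by
    by_contra hc
    push Not at hc
    simp only [ell, hc, if_true] at hei
    have := (hs i).2
    linarith
  have hN1 := (hN i).1 hi
  unfold ell at hei
  rw [if_neg (not_lt.2 hi)] at hei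
  have h1 := opt_nec1 hF hr (h := h) hL hs (le_max_left _ _) hei (fun x hx => hN1.2 x
    ⟨⟨(le_max_left _ _).trans hx.1, hx.2.trans (hs i).2⟩, hx.2.trans hN1.1.2.1,
      (le_max_right _ _).trans hx.1⟩)
  have h2 := marg_lt hF hr hM hs i (hb i).1.1.1 hbi hbi
  rw [hm i hbi] at h2
  linarith

theorem lob_anti {n : ℕ} {M : ℝ} {F : ℝ → ℝ} (hF : Good M F)
    {a : Fin n → ℝ} {L : Fin n → (Fin n → ℝ) → ℝ}
    (hL : ∀ s, memD n a s → ∀ i, s i * L i s = RR n F s (s i))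
    (hL0 : ∀ s i, s i = 0 → L i s = 1)
    {s s' : Fin n → ℝ} (hs : memD n a s) (hs' : memD n a s') (hle : ∀ i, s i ≤ s' i)
    (i : Fin n) : L i s' ≤ L i s := by
  have e' := hL s' hs' i
  have e := hL s hs i
  rcases (hs' i).1.eq_or_lt with h0' | h0'
  · have : s i = 0 := le_antisymm (h0' ▸ hle i) (hs i).1
    rw [hL0 s i this, hL0 s' i h0'.symm]
  rcases (hs i).1.eq_or_lt with h0 | h0
  · rw [hL0 s i h0.symm]
    have h1 := RR_upper hF s' h0'.le
    rw [RR_zero] at h1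
    have h2 := mul_le_mul_of_nonneg_left (hF.le1 (VV n s' 0)) (sub_nonneg.2 h0'.le)
    have : s' i * L i s' ≤ s' i * 1 := by linarith
    exact le_of_mul_le_mul_left this h0'
  · have h1 := RR_upper hF s' (hle i)
    have h2 := RR_lower hF s' h0.le
    have h3 := RR_mono2 hF hle h0.le
    rw [RR_zero] at h2
    have h4 := mul_le_mul_of_nonneg_left h1 h0.le
    have h5 := mul_le_mul_of_nonneg_left h2 (sub_nonneg.2 (hle i))
    have h6 := mul_le_mul_of_nonneg_left h3 h0'.le
    have h7 : s i * RR n F s' (s' i) ≤ s' i * RR n F s (s i) := by nlinarith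
    rw [← e, ← e'] at h7
    have h8 : (s i * s' i) * L i s' ≤ (s i * s' i) * L i s := by linarith
    exact le_of_mul_le_mul_left h8 (mul_pos h0 h0')

theorem good_ext {M : ℝ} {f : ℝ → ℝ} (hM : 0 ≤ M) (hf : Assumption2 M f) :
    Good M (Set.IccExtend hM (fun x => f x.1)) := by
  have hc : ContinuousOn f (Set.Icc 0 M) := hf.smooth.continuousOn
  refine ⟨?_, ?_, ?_, ?_, ?_, ?_⟩
  · exact (continuousOn_iff_continuous_restrict.1 hc).Icc_extend'
  · intro x y hxy
    exact hf.anti.antitoneOn (Set.projIcc 0 M hM x).2 (Set.projIcc 0 M hM y).2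
      (Set.monotone_projIcc hM hxy)
  · intro x; exact (hf.mem _ (Set.projIcc 0 M hM x).2).1
  · intro x; exact (hf.mem _ (Set.projIcc 0 M hM x).2).2
  · intro x hx y hy hxy
    rw [Set.IccExtend_of_mem hM _ hx, Set.IccExtend_of_mem hM _ hy]
    exact hf.anti hx hy hxy
  · rw [Set.IccExtend_of_mem hM _ (Set.left_mem_Icc.2 hM)]
    exact hf.f_zero

theorem lob_eq {n : ℕ} {M : ℝ} {f : ℝ → ℝ} (hM0 : 0 ≤ M) {a : Fin n → ℝ}
    (hM : ∑ i, a i ≤ M) (s : Fin n → ℝ) (hs : memD n a s) (i : Fin n) :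
    s i * lob n f i s = RR n (Set.IccExtend hM0 (fun x => f x.1)) s (s i) := by
  have : RR n (Set.IccExtend hM0 (fun x => f x.1)) s (s i) =
      ∫ u in (0:ℝ)..(s i), f (∑ j, min (s j) u) := by
    unfold RR
    apply intervalIntegral.integral_congr
    intro u hu
    rw [Set.uIcc_of_le (hs i).1] at hu
    simp only
    rw [Set.IccExtend_of_mem hM0 _ (VV_mem hM hs hu.1)]
    rfl
  unfold lob
  split_ifs with h0
  · rw [h0, RR_zero]; simp
  · rw [this]; field_simp

/-- under LOB pricing, Assumption 2 and Assumptions 1(3)-1(4) on `g`, there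
exist a greatest and a least clearing price vector, and the set of clearing liquidation
vectors has a greatest and a least element (componentwise). -/
theorem lob_greatest_and_least_clearing
    (n : ℕ) (a h : Fin n → ℝ) (r M : ℝ) (f g : ℝ → ℝ)
    (ha : ∀ i, 0 < a i) (hh : ∀ i, 0 < h i) (hr : 0 ≤ r)
    (hM : ∑ i, a i ≤ M)
    (hf : Assumption2 M f)
    (hg_mem : ∀ x ∈ Set.Icc (0 : ℝ) M, g x ∈ Set.Ioc (0 : ℝ) 1)
    (hg_cont : ContinuousOn g (Set.Icc 0 M))
    (hg_convex : ConvexOn ℝ (Set.Icc 0 M) g)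
    (hg_anti : StrictAntiOn g (Set.Icc 0 M))
    (hg_lt : ∀ s, memD n a s → ∀ i, g (∑ j, s j) < lob n f i s)
    (hg_total_mono : ∀ i s, memD n a s →
      StrictMonoOn
        (fun x => x * lob n f i (Function.update s i x)
          + (a i - x) * g (∑ j, Function.update s i x j)) (Set.Icc 0 (a i))) :
    (∃ (qup : ℝ) (qbup : Fin n → ℝ) (qdn : ℝ) (qbdn : Fin n → ℝ),
      ClearingLOB n a h r f g qup qbup ∧
      ClearingLOB n a h r f g qdn qbdn ∧
      ∀ q qb, ClearingLOB n a h r f g q qb →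
        (qdn ≤ q ∧ q ≤ qup) ∧ ∀ i, qbdn i ≤ qb i ∧ qb i ≤ qbup i) ∧
    (∃ shi slo : Fin n → ℝ,
      ClearingLiqLOB n a h r f g shi ∧
      ClearingLiqLOB n a h r f g slo ∧
      ∀ s, ClearingLiqLOB n a h r f g s → ∀ i, slo i ≤ s i ∧ s i ≤ shi i) := by

  have hM0 : 0 ≤ M := (Finset.sum_nonneg fun i _ => (ha i).le).trans hM
  have hF := good_ext hM0 hf
  have hL := lob_eq (f := f) hM0 hM
  have hL0 : ∀ (s : Fin n → ℝ) i, s i = 0 → lob n f i s = 1 := fun s i h0 => by simp [lob, h0]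
  obtain ⟨b, hb⟩ := exists_b hF ha hh hr
  have hsum : ∀ s, memD n a s → ∑ i, s i ∈ Set.Icc 0 M := fun s hs =>
    ⟨Finset.sum_nonneg fun i _ => (hs i).1, (Finset.sum_le_sum fun i _ => (hs i).2).trans hM⟩
  have hgm : ∀ s s', memD n a s → memD n a s' → (∀ i, s i ≤ s' i) →
      g (∑ i, s' i) ≤ g (∑ i, s i) := fun s s' hs hs' hle =>
    hg_anti.antitoneOn (hsum s hs) (hsum s' hs') (Finset.sum_le_sum fun i _ => hle i)
  have hD : ∀ s : Fin n → ℝ, s ∈ Set.Icc (0 : Fin n → ℝ) a ↔ memD n a s := fun s =>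
    ⟨fun hs i => ⟨hs.1 i, hs.2 i⟩, fun hs => ⟨fun i => (hs i).1, fun i => (hs i).2⟩⟩
  obtain ⟨x, y, ⟨hx, hTx⟩, ⟨hy, hTy⟩, hxy⟩ := tarski (lo := 0) (hi := a) (fun i => (ha i).le)
    (fun s i => max (b i) (ell (a i) (h i) (lob n f i s) (g (∑ j, s j))))
    (by
      intro s hs
      have hs' := (hD s).1 hs
      rw [hD]
      intro i
      have := ell_mem (h := h i) (ha i) (hg_lt s hs' i)
      exact ⟨(hb i).1.1.1.trans (le_max_left _ _), max_le (hb i).1.1.2 this.2⟩)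
    (by
      intro s hs s' hs' hle i
      rw [hD] at hs hs'
      exact max_le_max_left _ (ell_mono (ha i) (hg_lt s hs i) (hg_lt s' hs' i)
        (lob_anti hF hL hL0 hs hs' hle i) (hgm s s' hs hs' hle)))
  rw [hD] at hx hy
  have hcl : ∀ s, memD n a s →
      (fun i => max (b i) (ell (a i) (h i) (lob n f i s) (g (∑ j, s j)))) = s →
      ClearingLiqLOB n a h r f g s := fun s hs hT =>
    ⟨hs, clearing_of_fix hF hr hM ha hh hb hL hs (hg_mem _ (hsum s hs)).1 (hg_lt s hs)
      (fun i => (congrFun hT i).symm)⟩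
  have hbd : ∀ s, ClearingLiqLOB n a h r f g s → x ≤ s ∧ s ≤ y := fun s hs =>
    hxy s ((hD s).2 hs.1) (funext fun i => (fix_of_clearing hF hr hM hb hL hs.1
      (hg_mem _ (hsum s hs.1)).1 (hg_lt s hs.1) hs.2 i).symm)
  have hcx := hcl x hx hTx
  have hcy := hcl y hy hTy
  refine ⟨⟨g (∑ i, x i), fun i => lob n f i x, g (∑ i, y i), fun i => lob n f i y,
    ⟨x, hx, hcx.2, rfl, fun _ => rfl⟩, ⟨y, hy, hcy.2, rfl, fun _ => rfl⟩, ?_⟩,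
    y, x, hcy, hcx, fun s hs i => ⟨(hbd s hs).1 i, (hbd s hs).2 i⟩⟩
  rintro q qb ⟨s, hs, hN, rfl, hqb⟩
  obtain rfl : qb = fun i => lob n f i s := funext hqb
  obtain ⟨h1, h2⟩ := hbd s ⟨hs, hN⟩
  exact ⟨⟨hgm s y hs hy h2, hgm x s hx hs h1⟩, fun i =>
    ⟨lob_anti hF hL hL0 hs hy h2 i, lob_anti hF hL hL0 hx hs h1 i⟩⟩
end
end

section
/- Under the VWAP pricing structure, Assumption 2, Assumptions 1(3)-1(4) on a continuously differentiable haircut function g, and assuming every bank is fundamentally solvent (h_i ≤ a_i·f̄_i(a_1,...,a_n) for all i), if −3M·min((1/2)f'(0), g'(0)) < min_j min_{s ∈ D} (f̄_j(s) − g(Σ_{i=1}^n s_i)), then there exists exactly one clearing price vector (q*, q̄_1*,...,q̄_n*). -/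
noncomputable section

/-- Volume weighted average price. -/
def vwap (n : ℕ) (f : ℝ → ℝ) : Fin n → (Fin n → ℝ) → ℝ := fun _ s =>
  if (∑ j, s j) = 0 then 1 else (∫ σ in (0:ℝ)..(∑ j, s j), f σ) / (∑ j, s j)

/-- `(q, q̄)` is a clearing price vector under VWAP pricing. -/
def ClearingVWAP (n : ℕ) (a h : Fin n → ℝ) (r : ℝ) (f g : ℝ → ℝ)
    (q : ℝ) (qb : Fin n → ℝ) : Prop :=
  ∃ s : Fin n → ℝ, memD n a s ∧ NashP2 n a h r q qb (vwap n f) s ∧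
    q = g (∑ i, s i) ∧ ∀ i, qb i = vwap n f i s

/-- Price as a function of total liquidation. -/
def Fv (f : ℝ → ℝ) (S : ℝ) : ℝ := if S = 0 then 1 else (∫ σ in (0:ℝ)..S, f σ) / S

lemma Fv_mul (f : ℝ → ℝ) (S : ℝ) : S * Fv f S = ∫ σ in (0:ℝ)..S, f σ := by
  unfold Fv
  split_ifs with h
  · simp [h]
  · field_simp

lemma A2_convex {M : ℝ} {f : ℝ → ℝ} (hf : Assumption2 M f) : ConvexOn ℝ (Set.Icc 0 M) f := by
  apply MonotoneOn.convexOn_of_deriv (convex_Icc 0 M) hf.smooth.continuousOn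
  · exact (hf.smooth.differentiableOn (by norm_num)).mono interior_subset
  · intro x hx y hy hxy
    have e : ∀ z ∈ interior (Set.Icc (0:ℝ) M), derivWithin f (Set.Icc 0 M) z = deriv f z :=
      fun z hz => derivWithin_of_mem_nhds (mem_interior_iff_mem_nhds.1 hz)
    rw [← e x hx, ← e y hy]
    exact hf.deriv_mono (interior_subset hx) (interior_subset hy) hxy

lemma conv3 {M : ℝ} {f : ℝ → ℝ} (hc : ConvexOn ℝ (Set.Icc 0 M) f) {x y z : ℝ}
    (hx : 0 ≤ x) (hxy : x ≤ y) (hyz : y ≤ z) (hz : z ≤ M) :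
    (z - x) * f y ≤ (z - y) * f x + (y - x) * f z := by
  rcases hxy.eq_or_lt with rfl | h1
  · simp
  rcases hyz.eq_or_lt with rfl | h2
  · simp
  have := hc.slope_mono_adjacent (x := x) (y := y) (z := z) ⟨hx, by linarith⟩
    ⟨by linarith, hz⟩ h1 h2
  rw [div_le_div_iff₀ (by linarith) (by linarith)] at this
  nlinarith

lemma subgrad {M : ℝ} {f : ℝ → ℝ} (hc : ConvexOn ℝ (Set.Icc 0 M) f)
    (hd : DifferentiableOn ℝ f (Set.Icc 0 M)) {x y : ℝ} (hx : x ∈ Set.Icc 0 M)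
    (hy : y ∈ Set.Icc 0 M) : f x + derivWithin f (Set.Icc 0 M) x * (y - x) ≤ f y := by
  rcases lt_trichotomy x y with h | h | h
  · have := hc.derivWithin_le_slope hx hy h (hd x hx)
    rw [slope_def_field, le_div_iff₀ (by linarith)] at this
    linarith
  · subst h; simp
  · have := hc.slope_le_derivWithin hy hx h (hd x hx)
    rw [slope_def_field, div_le_iff₀ (by linarith)] at this
    linarith

lemma lip0 {M : ℝ} {f : ℝ → ℝ} (hc : ConvexOn ℝ (Set.Icc 0 M) f)
    (hd : DifferentiableOn ℝ f (Set.Icc 0 M)) {x y : ℝ} (hx : 0 ≤ x) (hxy : x ≤ y) (hy : y ≤ M) :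
    f x - f y ≤ - derivWithin f (Set.Icc 0 M) 0 * (y - x) := by
  rcases hxy.eq_or_lt with rfl | h1
  · simp
  have h2 := subgrad hc hd (x := 0) (y := y) ⟨le_rfl, by linarith⟩ ⟨by linarith, hy⟩
  have h3 := conv3 hc le_rfl hx hxy hy
  have hy0 : 0 < y := by linarith
  have : y * (f x - f y) ≤ y * (- derivWithin f (Set.Icc 0 M) 0 * (y - x)) := by
    nlinarith
  exact le_of_mul_le_mul_left this hy0

lemma A2_int {M : ℝ} {f : ℝ → ℝ} (hf : Assumption2 M f) {u v : ℝ} (hu : 0 ≤ u) (huv : u ≤ v)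
    (hv : v ≤ M) : IntervalIntegrable f MeasureTheory.volume u v := by
  apply ContinuousOn.intervalIntegrable
  rw [Set.uIcc_of_le huv]
  exact hf.smooth.continuousOn.mono (Set.Icc_subset_Icc hu hv)

lemma int_aff (α β u v : ℝ) : ∫ σ in u..v, (α + β * σ) = α * (v - u) + β * (v^2 - u^2) / 2 := by
  rw [intervalIntegral.integral_add (by simp) (by apply Continuous.intervalIntegrable; fun_prop)]
  rw [intervalIntegral.integral_const_mul, integral_id]
  simp; ring

lemma low_aff {M : ℝ} {f : ℝ → ℝ} (hf : Assumption2 M f) {u v : ℝ} (hu : 0 ≤ u) (huv : u ≤ v)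
    (hv : v ≤ M) (α β : ℝ) (h : ∀ σ ∈ Set.Icc u v, α + β * σ ≤ f σ) :
    α * (v - u) + β * (v^2 - u^2) / 2 ≤ ∫ σ in u..v, f σ := by
  rw [← int_aff]
  exact intervalIntegral.integral_mono_on huv
    (by apply Continuous.intervalIntegrable; fun_prop) (A2_int hf hu huv hv) h

lemma up_aff {M : ℝ} {f : ℝ → ℝ} (hf : Assumption2 M f) {u v : ℝ} (hu : 0 ≤ u) (huv : u ≤ v)
    (hv : v ≤ M) (α β : ℝ) (h : ∀ σ ∈ Set.Icc u v, f σ ≤ α + β * σ) :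
    ∫ σ in u..v, f σ ≤ α * (v - u) + β * (v^2 - u^2) / 2 := by
  rw [← int_aff]
  exact intervalIntegral.integral_mono_on huv (A2_int hf hu huv hv)
    (by apply Continuous.intervalIntegrable; fun_prop) h

lemma trap {M : ℝ} {f : ℝ → ℝ} (hf : Assumption2 M f) {u v : ℝ} (hu : 0 ≤ u) (huv : u ≤ v)
    (hv : v ≤ M) : ∫ σ in u..v, f σ ≤ (v - u) * (f u + f v) / 2 := by
  rcases huv.eq_or_lt with rfl | h1
  · simp
  have hp : 0 < v - u := by linarith
  have := up_aff hf hu huv hv ((v * f u - u * f v) / (v - u)) ((f v - f u) / (v - u)) (by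
    intro σ hσ
    have := conv3 (A2_convex hf) hu hσ.1 hσ.2 hv
    rw [div_mul_eq_mul_div, ← add_div, le_div_iff₀ hp]
    linarith)
  refine this.trans (le_of_eq ?_)
  field_simp
  ring

lemma int_split {M : ℝ} {f : ℝ → ℝ} (hf : Assumption2 M f) {u v : ℝ} (hu : 0 ≤ u) (huv : u ≤ v)
    (hv : v ≤ M) : v * Fv f v = u * Fv f u + ∫ σ in u..v, f σ := by
  rw [Fv_mul, Fv_mul, intervalIntegral.integral_add_adjacent_intervals
    (A2_int hf le_rfl hu (by linarith)) (A2_int hf hu huv hv)]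

lemma int_bds {M : ℝ} {f : ℝ → ℝ} (hf : Assumption2 M f) {u v : ℝ} (hu : 0 ≤ u) (huv : u ≤ v)
    (hv : v ≤ M) : (v - u) * f v ≤ ∫ σ in u..v, f σ ∧ ∫ σ in u..v, f σ ≤ (v - u) * f u := by
  have h1 := low_aff hf hu huv hv (f v) 0 (by
    intro σ hσ
    have := hf.anti.antitoneOn (a := σ) (b := v) ⟨by linarith [hσ.1], by linarith [hσ.2]⟩
      ⟨by linarith, hv⟩ hσ.2
    linarith)
  have h2 := up_aff hf hu huv hv (f u) 0 (by
    intro σ hσ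
    have := hf.anti.antitoneOn (a := u) (b := σ) ⟨hu, by linarith⟩
      ⟨by linarith [hσ.1], by linarith [hσ.2]⟩ hσ.1
    linarith)
  constructor <;> linarith

/-- `F > f` for positive `S`. -/
lemma F_gt {M : ℝ} {f : ℝ → ℝ} (hf : Assumption2 M f) {S : ℝ} (h0 : 0 < S) (hM : S ≤ M) :
    f S < Fv f S := by
  have h1 := int_split hf (u := 0) (v := S / 2) le_rfl (by linarith) (by linarith)
  have h2 := int_split hf (u := S / 2) (v := S) (by linarith) (by linarith) (by linarith)
  have h3 := (int_bds hf (u := 0) (v := S / 2) le_rfl (by linarith) (by linarith)).1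
  have h4 := (int_bds hf (u := S / 2) (v := S) (by linarith) (by linarith) (by linarith)).1
  have h5 : f S < f (S / 2) := hf.anti ⟨by linarith, by linarith⟩ ⟨by linarith, hM⟩ (by linarith)
  have : S * f S < S * Fv f S := by nlinarith
  exact lt_of_mul_lt_mul_left this h0.le

lemma F_zero (f : ℝ → ℝ) : Fv f 0 = 1 := by simp [Fv]

lemma F_lt_one {M : ℝ} {f : ℝ → ℝ} (hf : Assumption2 M f) {S : ℝ} (h0 : 0 < S) (hM : S ≤ M) :
    Fv f S < 1 := by
  have h1 := int_split hf (u := 0) (v := S) le_rfl (by linarith) (by linarith)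
  have h3 := trap hf (u := 0) (v := S) le_rfl (by linarith) (by linarith)
  have h5 : f S < f 0 := hf.anti ⟨by linarith, by linarith⟩ ⟨by linarith, hM⟩ (by linarith)
  rw [hf.f_zero] at h3 h5
  have : S * Fv f S < S * 1 := by nlinarith
  exact lt_of_mul_lt_mul_left this h0.le

lemma F_anti {M : ℝ} {f : ℝ → ℝ} (hf : Assumption2 M f) {S T : ℝ} (h0 : 0 ≤ S) (hST : S < T)
    (hM : T ≤ M) : Fv f T < Fv f S := by
  rcases h0.eq_or_lt with rfl | h
  · rw [F_zero]; exact F_lt_one hf hST hM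
  have h1 := int_split hf h0 hST.le hM
  have h2 := (int_bds hf h0 hST.le hM).2
  have h3 := F_gt hf h (by linarith)
  have : T * Fv f T < T * Fv f S := by nlinarith
  exact lt_of_mul_lt_mul_left this (by linarith)

lemma F_pos {M : ℝ} {f : ℝ → ℝ} (hf : Assumption2 M f) {S : ℝ} (h0 : 0 ≤ S) (hM : S ≤ M) :
    0 < Fv f S := by
  rcases h0.eq_or_lt with rfl | h
  · rw [F_zero]; exact one_pos
  exact ((hf.mem S ⟨h0, hM⟩).1).trans (F_gt hf h hM)

/-- Tangent inequality for `F`. -/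
lemma F_tangent {M : ℝ} {f : ℝ → ℝ} (hf : Assumption2 M f) {S X : ℝ} (hS : 0 < S) (hSM : S ≤ M)
    (hX : 0 ≤ X) (hXM : X ≤ M) :
    Fv f S - (X - S) * ((Fv f S - f S) / S) ≤ Fv f X := by
  have hc := A2_convex hf
  have hdiff := hf.smooth.differentiableOn (by norm_num)
  rcases hX.eq_or_lt with rfl | hX0
  · rw [F_zero]
    have h1 := int_split hf (u := 0) (v := S) le_rfl (by linarith) (by linarith)
    have h3 := trap hf (u := 0) (v := S) le_rfl (by linarith) (by linarith)
    rw [hf.f_zero] at h3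
    have : S * (2 * Fv f S) ≤ S * (1 + f S) := by nlinarith
    have := le_of_mul_le_mul_left this hS
    have e : (0 - S) * ((Fv f S - f S) / S) = - (Fv f S - f S) := by field_simp; ring
    rw [e]; linarith
  set e := (Fv f S - f S) / S with he
  have heS : e * S = Fv f S - f S := by rw [he]; field_simp
  refine le_of_mul_le_mul_left ?_ hX0
  rcases le_total S X with h | h
  · have hsp := int_split hf hS.le h hXM
    set p := derivWithin f (Set.Icc 0 M) S
    have hsub : ∀ σ ∈ Set.Icc 0 M, f S - p * S + p * σ ≤ f σ := by
      intro σ hσ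
      have := subgrad hc hdiff (x := S) ⟨hS.le, hSM⟩ hσ
      linarith
    have h1 := low_aff hf le_rfl hS.le hSM (f S - p * S) p
      (fun σ hσ => hsub σ ⟨hσ.1, by linarith [hσ.2]⟩)
    have h2 := low_aff hf hS.le h hXM (f S - p * S) p
      (fun σ hσ => hsub σ ⟨by linarith [hσ.1], by linarith [hσ.2]⟩)
    rw [← Fv_mul] at h1
    have h3 : S * (S * -p) ≤ S * (2 * (e * S)) := by nlinarith
    have h4 : S * -p ≤ S * (2 * e) := by
      have := le_of_mul_le_mul_left h3 hS; linarith
    have h5 := le_of_mul_le_mul_left h4 hS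
    have h6 : -p * (X - S)^2 ≤ 2 * e * (X - S)^2 := by gcongr
    have hF : Fv f S = f S + e * S := by linarith
    rw [hF] at hsp ⊢
    rw [hsp]
    nlinarith
  · rcases h.eq_or_lt with rfl | hlt
    · simp
    have hsp := int_split hf hX hlt.le hSM
    have hδ : 0 < S - X := by linarith
    have h1 := trap hf hX hlt.le hSM
    have h2 := low_aff hf le_rfl hX hXM ((S * f X - X * f S) / (S - X)) ((f S - f X) / (S - X)) (by
      intro σ hσ
      have := conv3 hc hσ.1 hσ.2 hlt.le hSM
      rw [div_mul_eq_mul_div, ← add_div, div_le_iff₀ hδ]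
      linarith)
    rw [← Fv_mul] at h2
    have hF : Fv f S = f S + e * S := by linarith
    set Y := ∫ σ in X..S, f σ
    set Z := X * Fv f X
    have h2' : (S * f X - X * f S) * X + (f S - f X) * X^2 / 2 ≤ (S - X) * Z := by
      have : (S - X) * ((S * f X - X * f S) / (S - X) * (X - 0) +
        (f S - f X) / (S - X) * (X ^ 2 - 0 ^ 2) / 2) =
        (S * f X - X * f S) * X + (f S - f X) * X^2 / 2 := by
        field_simp; ring
      rw [← this]; exact mul_le_mul_of_nonneg_left h2 hδ.le
    rw [hF] at hsp ⊢
    -- with Y' = Y - δ f S and Z' = Z - X f S: Y' + Z' = e S^2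
    have hYZ : (Y - (S - X) * f S) + (Z - X * f S) = e * S^2 := by linarith
    have a1 : (Y - (S - X) * f S) ≤ (S - X) * (f X - f S) / 2 := by linarith
    have a2 : (f X - f S) * (X * (2 * S - X)) / 2 ≤ (S - X) * (Z - X * f S) := by nlinarith
    have key : (S - X) * 0 ≤ (S - X) * (S^2 * (Z - X * f S - (e * S^2 - e * (S - X)^2))) := by
      have e1 : e * S^2 * (S^2 - (S-X)^2) =
        ((Y - (S - X) * f S) + (Z - X * f S)) * (S^2 - (S-X)^2) := by rw [hYZ]
      have a3 : (Y - (S - X) * f S) * ((S - X) * (X * (2 * S - X)))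
          ≤ (S - X) * (f X - f S) / 2 * ((S - X) * (X * (2 * S - X))) := by
        apply mul_le_mul_of_nonneg_right a1
        have : 0 ≤ 2 * S - X := by linarith
        positivity
      have a4 := mul_le_mul_of_nonneg_left a2 (sq_nonneg (S - X))
      nlinarith
    have key2 := le_of_mul_le_mul_left key hδ
    have key3 : S^2 * (e * S^2 - e * (S - X)^2) ≤ S^2 * (Z - X * f S) := by linarith
    have key4 := le_of_mul_le_mul_left key3 (by positivity)
    nlinarith

lemma F_lip {M : ℝ} {f : ℝ → ℝ} (hf : Assumption2 M f) {S T : ℝ} (h0 : 0 ≤ S) (hST : S ≤ T)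
    (hM : T ≤ M) : Fv f S - Fv f T ≤ -((1/2) * derivWithin f (Set.Icc 0 M) 0) * (T - S) := by
  have hc := A2_convex hf
  have hdiff := hf.smooth.differentiableOn (n := 2) (by norm_num)
  set p := derivWithin f (Set.Icc 0 M) 0 with hp
  rcases h0.eq_or_lt with rfl | h
  · rcases hST.eq_or_lt with rfl | h1
    · simp
    have h2 := low_aff hf le_rfl hST hM 1 p (by
      intro σ hσ
      have := subgrad hc hdiff (x := 0) (y := σ) ⟨le_rfl, by linarith⟩ ⟨hσ.1, by linarith [hσ.2]⟩
      rw [hf.f_zero, ← hp] at this; linarith)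
    rw [← Fv_mul] at h2
    rw [F_zero]
    have : T * (1 + p * T / 2) ≤ T * Fv f T := by nlinarith
    have := le_of_mul_le_mul_left this h1
    linarith
  · have h1 := F_tangent hf h (by linarith) (h0.trans hST) hM
    have h2 := up_aff hf le_rfl h0 (by linarith) (f S - p * S) p (by
      intro σ hσ
      have := lip0 hc hdiff hσ.1 hσ.2 (by linarith)
      rw [← hp] at this; linarith)
    rw [← Fv_mul] at h2
    have h3 : S * (Fv f S - f S) ≤ S * (- (1/2 * p) * S) := by nlinarith
    have h4 := le_of_mul_le_mul_left h3 h
    have h5 : (Fv f S - f S) / S ≤ - (1/2 * p) := by rw [div_le_iff₀ h]; exact h4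
    have h6 := mul_le_mul_of_nonneg_left h5 (sub_nonneg.2 hST)
    linarith

lemma d_anti {M : ℝ} {f : ℝ → ℝ} (hf : Assumption2 M f) {S T : ℝ} (h0 : 0 < S) (hST : S < T)
    (hM : T ≤ M) : (Fv f T - f T) / T ≤ (Fv f S - f S) / S := by
  have h1 := F_tangent hf h0 (by linarith) (by linarith) hM
  have h2 := F_tangent hf (by linarith) hM h0.le (by linarith : S ≤ M)
  have : (T - S) * ((Fv f T - f T) / T) ≤ (T - S) * ((Fv f S - f S) / S) := by linarith
  exact le_of_mul_le_mul_left this (by linarith)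

/-- Tangent inequality for proceeds `x F(x+c)`. -/
lemma proceeds_tangent {M : ℝ} {f : ℝ → ℝ} (hf : Assumption2 M f) {c s x : ℝ} (hc : 0 ≤ c)
    (hx : 0 ≤ x) (hS : 0 < s + c) (hSM : s + c ≤ M) (hXM : x + c ≤ M) :
    x * Fv f (x + c) ≤ s * Fv f (s + c) +
      (x - s) * (Fv f (s + c) - s * ((Fv f (s + c) - f (s + c)) / (s + c))) := by
  have h1 := F_tangent hf hS hSM (by linarith : 0 ≤ x + c) hXM
  have hI : (x + c) * Fv f (x + c) ≤ (s + c) * Fv f (s + c) + (x - s) * f (s + c) := by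
    rcases le_total s x with h | h
    · have h2 := int_split hf hS.le (by linarith : s + c ≤ x + c) hXM
      have h3 := (int_bds hf hS.le (by linarith : s + c ≤ x + c) hXM).2
      linarith
    · have h2 := int_split hf (by linarith : 0 ≤ x + c) (by linarith : x + c ≤ s + c) hSM
      have h3 := (int_bds hf (by linarith : 0 ≤ x + c) (by linarith : x + c ≤ s + c) hSM).1
      linarith
  set e := (Fv f (s + c) - f (s + c)) / (s + c) with he
  have heS : e * (s + c) = Fv f (s + c) - f (s + c) := by rw [he]; field_simp
  have hfe : f (s + c) = Fv f (s + c) - e * (s + c) := by linarith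
  rw [hfe] at hI
  nlinarith [mul_le_mul_of_nonneg_left h1 hc]

lemma t_anti {M : ℝ} {f : ℝ → ℝ} (hf : Assumption2 M f) {S T ρ : ℝ} (h0 : 0 < S) (hST : S < T)
    (hM : T ≤ M) (hρ : Fv f S + f S ≤ 2 * ρ) :
    (Fv f T - ρ) / ((Fv f T - f T) / T) ≤ (Fv f S - ρ) / ((Fv f S - f S) / S) := by
  have hd := d_anti hf h0 hST hM
  have hT : 0 < T := by linarith
  have p1 : 0 < (Fv f T - f T) / T := div_pos (by linarith [F_gt hf hT hM]) hT
  have p2 : 0 < (Fv f S - f S) / S := div_pos (by linarith [F_gt hf h0 (by linarith)]) h0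
  have hsp := int_split hf h0.le hST.le hM
  have htr := trap hf h0.le hST.le hM
  have hFS := F_gt hf h0 (by linarith)
  have hff : f T < f S := hf.anti ⟨h0.le, by linarith⟩ ⟨by linarith, hM⟩ hST
  rw [div_le_div_iff₀ p1 p2]
  set d := (Fv f S - f S) / S with hdd
  set d' := (Fv f T - f T) / T with hdd'
  have e1 : d * S = Fv f S - f S := by rw [hdd]; field_simp
  have e2 : d' * T = Fv f T - f T := by rw [hdd']; field_simp
  obtain ⟨Δ, hΔ, rfl⟩ : ∃ Δ, 0 < Δ ∧ T = S + Δ := ⟨T - S, by linarith, by ring⟩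
  -- main inequality at the extreme value of ρ
  have main : Fv f (S + Δ) - (Fv f S + f S) / 2 ≤ S * d' / 2 := by
    have hI : (S + Δ) * Fv f (S + Δ) ≤ S * Fv f S + Δ * (f S + f (S + Δ)) / 2 := by
      rw [hsp]; linarith
    have hT2 : 0 < (S + Δ) := hT
    have : (S + Δ) * (2 * Fv f (S + Δ) - (Fv f S + f S)) ≤ (S + Δ) * (S * d') := by
      have e3 : (S + Δ) * (S * d') = S * (Fv f (S + Δ) - f (S + Δ)) := by rw [← e2]; ring
      rw [e3]
      refine le_of_mul_le_mul_left ?_ hT2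
      have h7 := mul_le_mul_of_nonneg_left hI (by linarith : 0 ≤ S + 2 * Δ)
      have h8 := mul_le_mul_of_nonneg_left hFS.le (sq_nonneg Δ)
      have h9 := mul_le_mul_of_nonneg_left hff.le
        (by positivity : 0 ≤ S^2 + 3/2 * (S * Δ) + Δ^2)
      nlinarith
    have := le_of_mul_le_mul_left this hT2
    linarith
  have m1 := mul_le_mul_of_nonneg_right main p2.le
  have m2 := mul_le_mul_of_nonneg_left hd (by linarith : 0 ≤ ρ - (Fv f S + f S) / 2)
  nlinarith

/-- The common interior target. -/
def tv (f : ℝ → ℝ) (ρ S : ℝ) : ℝ := (Fv f S - ρ) / ((Fv f S - f S) / S)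

def KKT (n : ℕ) (a h : Fin n → ℝ) (ρ : ℝ) (f g : ℝ → ℝ) (s : Fin n → ℝ) (S : ℝ) : Prop :=
  (∀ i, 0 ≤ s i ∧ s i ≤ a i ∧ s i ≤ h i / Fv f S ∧
    (h i - a i * g S) / (Fv f S - g S) ≤ s i) ∧
  (S = 0 → 1 ≤ ρ) ∧
  (0 < S → ∀ i, (0 < s i → (h i - a i * g S) / (Fv f S - g S) < s i → s i ≤ tv f ρ S) ∧
    (s i < h i / Fv f S → tv f ρ S ≤ s i))

lemma L_lip {a h F F' G G' Δ M K : ℝ} (ha : 0 < a) (hM : 0 < M)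
    (hD : G < F) (hD' : G' < F') (hF : F - F' ≤ K * Δ) (hG : G - G' ≤ K * Δ) (hΔ : 0 ≤ Δ)
    (hK : 3 * M * K < F - G) (hl : 0 ≤ (h - a * G') / (F' - G'))
    (hu : (h - a * G') / (F' - G') ≤ a) :
    (h - a * G') / (F' - G') - (h - a * G) / (F - G) ≤ a / (3 * M) * Δ := by
  have p : 0 < F - G := by linarith
  have p' : 0 < F' - G' := by linarith
  set l' := (h - a * G') / (F' - G') with hl'
  set l := (h - a * G) / (F - G) with hl0
  have e' : l' * (F' - G') = h - a * G' := by rw [hl']; field_simp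
  have e : l * (F - G) = h - a * G := by rw [hl0]; field_simp
  have h1 : (l' - l) * (F - G) = l' * (F - F') + (a - l') * (G - G') := by linarith
  have h2 : (l' - l) * (F - G) ≤ a * (K * Δ) := by
    rw [h1]
    nlinarith [mul_le_mul_of_nonneg_left hF hl,
      mul_le_mul_of_nonneg_left hG (by linarith : 0 ≤ a - l')]
  have h3 : a * (K * Δ) ≤ (a / (3 * M) * Δ) * (F - G) := by
    have : a * (K * Δ) = (a / (3 * M) * Δ) * (3 * M * K) := by field_simp
    rw [this]
    exact mul_le_mul_of_nonneg_left hK.le (by positivity)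
  exact le_of_mul_le_mul_right (h2.trans h3) p

lemma U_lip {a h F F' G Δ M K : ℝ} (ha : 0 < a) (hM : 0 < M)
    (hG : 0 < G) (hF0 : G < F) (hF' : 0 < F') (hFF : F' ≤ F) (hF : F - F' ≤ K * Δ) (hΔ : 0 ≤ Δ)
    (hK : 3 * M * K < F - G) (hu : h / F' ≤ a) (hh : 0 < h) :
    h / F' - h / F ≤ a / (3 * M) * Δ := by
  have p : 0 < F := by linarith
  set u' := h / F' with hu'
  set u := h / F with hu0
  have e' : u' * F' = h := by rw [hu']; field_simp
  have e : u * F = h := by rw [hu0]; field_simp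
  have hpos : 0 < u' := by positivity
  have h2 : (u' - u) * F ≤ a * (K * Δ) := by
    have h1 : (u' - u) * F = u' * (F - F') := by linarith
    rw [h1]
    exact mul_le_mul hu hF (by linarith) ha.le
  have h3 : a * (K * Δ) ≤ (a / (3 * M) * Δ) * F := by
    have : a * (K * Δ) = (a / (3 * M) * Δ) * (3 * M * K) := by field_simp
    rw [this]
    exact mul_le_mul_of_nonneg_left (by linarith) (by positivity)
  exact le_of_mul_le_mul_right (h2.trans h3) p

lemma kkt_unique_aux (n : ℕ) (hn : 0 < n) (a h : Fin n → ℝ) (M K ρ : ℝ) (f g : ℝ → ℝ)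
    (ha : ∀ i, 0 < a i) (hh : ∀ i, 0 < h i) (hM : ∑ i, a i ≤ M) (hM0 : 0 < M)
    (hf : Assumption2 M f)
    (hg_mem : ∀ x ∈ Set.Icc (0 : ℝ) M, 0 < g x)
    (hgF : ∀ S ∈ Set.Icc (0 : ℝ) (∑ i, a i), g S < Fv f S)
    (hK : ∀ S ∈ Set.Icc (0 : ℝ) (∑ i, a i), 3 * M * K < Fv f S - g S)
    (hFl : ∀ S T, 0 ≤ S → S ≤ T → T ≤ M → Fv f S - Fv f T ≤ K * (T - S))
    (hgl : ∀ S T, 0 ≤ S → S ≤ T → T ≤ M → g S - g T ≤ K * (T - S))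
    (hU : ∀ S ∈ Set.Icc (0 : ℝ) (∑ i, a i), ∀ i, h i / Fv f S ≤ a i)
    (s s' : Fin n → ℝ) (S S' : ℝ) (hS : ∑ i, s i = S) (hS' : ∑ i, s' i = S')
    (k : KKT n a h ρ f g s S) (k' : KKT n a h ρ f g s' S') (hlt : S < S') : False := by
  obtain ⟨k1, k2, k3⟩ := k
  obtain ⟨k1', k2', k3'⟩ := k'
  have hS0 : 0 ≤ S := by rw [← hS]; exact Finset.sum_nonneg fun i _ => (k1 i).1
  have hSA' : S' ≤ ∑ i, a i := by rw [← hS']; exact Finset.sum_le_sum fun i _ => (k1' i).2.1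
  have hSA : S ≤ ∑ i, a i := by linarith
  have hSm : S ∈ Set.Icc (0 : ℝ) (∑ i, a i) := ⟨hS0, hSA⟩
  have hSm' : S' ∈ Set.Icc (0 : ℝ) (∑ i, a i) := ⟨by linarith, hSA'⟩
  have hSp' : 0 < S' := by linarith
  have hSM' : S' ≤ M := by linarith
  have hSM : S ≤ M := by linarith
  set Δ := S' - S with hΔ
  have hΔ0 : 0 < Δ := by linarith
  have hanti := F_anti hf hS0 hlt hSM'
  have hFpos' := F_pos hf hSp'.le hSM'
  have hFpos := F_pos hf hS0 hSM
  -- charging lemma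
  have hcsum : ∑ i, a i / (3 * M) * Δ ≤ Δ / 3 := by
    rw [← Finset.sum_mul, ← Finset.sum_div, div_mul_eq_mul_div, div_le_iff₀ (by positivity)]
    nlinarith
  have hall : ¬ ∀ i, s' i - s i ≤ a i / (3 * M) * Δ := by
    intro hA
    have := Finset.sum_le_sum (s := Finset.univ) fun i _ => hA i
    rw [Finset.sum_sub_distrib, hS, hS'] at this
    linarith
  have hc0 : ∀ i, 0 ≤ a i / (3 * M) * Δ := fun i => by have := ha i; positivity
  set t' := tv f ρ S' with ht'
  -- bad indices
  have hbad : ∀ i, t' < s' i → s' i - s i ≤ a i / (3 * M) * Δ := by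
    intro i hi
    rcases (k1' i).1.eq_or_lt with h0 | h0
    · rw [← h0]; linarith [hc0 i, (k1 i).1]
    have hl : s' i = (h i - a i * g S') / (Fv f S' - g S') := by
      by_contra hne
      have := (k3' hSp' i).1 h0 (lt_of_le_of_ne (k1' i).2.2.2 (Ne.symm hne))
      linarith
    have := L_lip (h := h i) (ha i) hM0 (hgF S hSm) (hgF S' hSm') (hFl S S' hS0 hlt.le hSM')
      (hgl S S' hS0 hlt.le hSM') hΔ0.le (hK S hSm) (by rw [← hl]; exact h0.le)
      (by rw [← hl]; exact (k1' i).2.1)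
    rw [← hl] at this
    linarith [(k1 i).2.2.2]
  have hUc : ∀ i, h i / Fv f S ≤ s i → s' i - s i ≤ a i / (3 * M) * Δ := by
    intro i hi
    have := U_lip (ha i) hM0 (hg_mem S ⟨hS0, hSM⟩) (hgF S hSm) hFpos' hanti.le
      (hFl S S' hS0 hlt.le hSM') hΔ0.le (hK S hSm) (hU S' hSm' i) (hh i)
    linarith [(k1' i).2.2.1]
  -- case t' ≤ 0
  have ht'pos : 0 < t' := by
    by_contra hneg
    apply hall
    intro i
    by_cases hi : t' < s' i
    · exact hbad i hi
    · linarith [hc0 i, (k1 i).1]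
  have hFgt' := F_gt hf hSp' hSM'
  have hd' : 0 < (Fv f S' - f S') / S' := div_pos (by linarith) hSp'
  have hρF' : ρ < Fv f S' := by
    by_contra hneg
    have : t' ≤ 0 := by
      rw [ht']; unfold tv
      exact div_nonpos_of_nonpos_of_nonneg (by linarith) hd'.le
    linarith
  have hSp : 0 < S := by
    rcases hS0.eq_or_lt with h0 | h0
    · have := k2 h0.symm
      have := F_lt_one hf hSp' hSM'
      linarith
    · exact h0
  have hFgt := F_gt hf hSp hSM
  have hff : f S' < f S := hf.anti ⟨hS0, hSM⟩ ⟨hSp'.le, hSM'⟩ hlt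
  have hd : 0 < (Fv f S - f S) / S := div_pos (by linarith) hSp
  set t := tv f ρ S with ht
  have het : t * (Fv f S - f S) = S * (Fv f S - ρ) := by
    rw [ht]; unfold tv
    have : Fv f S - f S ≠ 0 := by linarith
    field_simp
  have het' : t' * (Fv f S' - f S') = S' * (Fv f S' - ρ) := by
    rw [ht']; unfold tv
    have : Fv f S' - f S' ≠ 0 := by linarith
    field_simp
  have hsS : ∀ i, s i ≤ S := by
    intro i
    rw [← hS]
    exact Finset.single_le_sum (fun j _ => (k1 j).1) (Finset.mem_univ i)
  -- case ρ < f S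
  have hfρ : f S ≤ ρ := by
    by_contra hneg
    apply hall
    intro i
    apply hUc
    by_contra hlt2
    have h1 := (k3 hSp i).2 (by linarith)
    have h2 := hsS i
    have : t * (Fv f S - f S) ≤ S * (Fv f S - f S) :=
      mul_le_mul_of_nonneg_right (h1.trans h2) (by linarith)
    rw [het] at this
    have := le_of_mul_le_mul_left this hSp
    linarith
  have hratio : t' * S < t * S' := by
    have p1 : 0 < Fv f S - f S := by linarith
    have p2 : 0 < Fv f S' - f S' := by linarith
    have hk : (Fv f S' - ρ) * (Fv f S - f S) < (Fv f S - ρ) * (Fv f S' - f S') := by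
      have : (Fv f S' - ρ) * (ρ - f S) < (Fv f S - ρ) * (ρ - f S') := by
        apply mul_lt_mul' (by linarith) (by linarith) (by linarith) (by linarith)
      nlinarith
    have hk2 := mul_lt_mul_of_pos_left hk (mul_pos hSp hSp')
    have : (t' * S) * ((Fv f S - f S) * (Fv f S' - f S')) <
        (t * S') * ((Fv f S - f S) * (Fv f S' - f S')) := by
      have e1 : (t' * S) * ((Fv f S - f S) * (Fv f S' - f S')) =
        S * S' * ((Fv f S' - ρ) * (Fv f S - f S)) := by
        linear_combination (S * (Fv f S - f S)) * het'
      have e2 : (t * S') * ((Fv f S - f S) * (Fv f S' - f S')) =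
        S * S' * ((Fv f S - ρ) * (Fv f S' - f S')) := by
        linear_combination (S' * (Fv f S' - f S')) * het
      rw [e1, e2]; exact hk2
    exact lt_of_mul_lt_mul_right this (by positivity)
  -- U ratio
  have hUr : ∀ i, h i / Fv f S' * S < h i / Fv f S * S' := by
    intro i
    have h1 := int_split hf hS0 hlt.le hSM'
    have h2 := (int_bds hf hS0 hlt.le hSM').1
    have h3 := (hf.mem S' ⟨hSp'.le, hSM'⟩).1
    have h4 : S * Fv f S < S' * Fv f S' := by nlinarith
    rw [div_mul_eq_mul_div, div_mul_eq_mul_div, div_lt_div_iff₀ hFpos' hFpos]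
    have := mul_lt_mul_of_pos_left h4 (hh i)
    linarith
  -- exists bad
  obtain ⟨b, hb⟩ : ∃ b, t' < s' b := by
    by_contra hno
    push Not at hno
    have hst : ∀ i, s' i * S < s i * S' := by
      intro i
      by_cases hi : s i < h i / Fv f S
      · have h1 := (k3 hSp i).2 hi
        have h2 := mul_le_mul_of_nonneg_right (hno i) hS0
        have h3 := mul_le_mul_of_nonneg_right h1 hSp'.le
        linarith
      · have h1 := hUr i
        have h2 := mul_le_mul_of_nonneg_right (k1' i).2.2.1 hS0
        have h3 := mul_le_mul_of_nonneg_right (not_lt.1 hi) hSp'.le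
        linarith
    have := Finset.sum_lt_sum_of_nonempty (s := (Finset.univ : Finset (Fin n)))
      ⟨⟨0, hn⟩, Finset.mem_univ _⟩ (fun i _ => hst i)
    rw [← Finset.sum_mul, ← Finset.sum_mul, hS, hS'] at this
    linarith
  -- classification
  have hN2 : ∀ i, ¬ (s' i - s i ≤ a i / (3 * M) * Δ) → s' i ≤ t' ∧ t ≤ s i := by
    intro i hi
    refine ⟨?_, ?_⟩
    · by_contra hc; exact hi (hbad i (not_le.1 hc))
    · apply (k3 hSp i).2
      by_contra hc
      exact hi (hUc i (not_lt.1 hc))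
  by_cases htS : Fv f S + f S ≤ 2 * ρ
  · have htt : t' ≤ t := t_anti hf hSp hlt hSM' htS
    apply hall
    intro i
    by_contra hi
    obtain ⟨h1, h2⟩ := hN2 i hi
    apply hi
    linarith [hc0 i]
  · have htS2 : S < 2 * t := by
      have : S * (Fv f S - f S) < (2 * t) * (Fv f S - f S) := by
        have e : (2 * t) * (Fv f S - f S) = S * (2 * (Fv f S - ρ)) := by linear_combination 2 * het
        rw [e]
        exact mul_lt_mul_of_pos_left (by linarith) hSp
      exact lt_of_mul_lt_mul_right this (by linarith)
    have hj : ∃ j, ¬ (s' j - s j ≤ a j / (3 * M) * Δ) := by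
      by_contra hno; push Not at hno; exact hall hno
    obtain ⟨j, hj⟩ := hj
    obtain ⟨hj1, hj2⟩ := hN2 j hj
    have hoth : ∀ i, i ≠ j → s' i - s i ≤ a i / (3 * M) * Δ := by
      intro i hij
      by_contra hi
      obtain ⟨_, hi2⟩ := hN2 i hi
      have : s i + s j ≤ S := by
        rw [← hS, ← Finset.sum_pair hij]
        exact Finset.sum_le_sum_of_subset_of_nonneg (Finset.subset_univ _) (fun k _ _ => (k1 k).1)
      linarith
    have hbj : b ≠ j := by
      rintro rfl; linarith
    have hpair : s' b + s' j ≤ S' := by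
      rw [← hS', ← Finset.sum_pair hbj]
      exact Finset.sum_le_sum_of_subset_of_nonneg (Finset.subset_univ _) (fun k _ _ => (k1' k).1)
    have hjd : s' j - s j ≤ Δ / 2 := by
      have h1 : s' j * S ≤ s j * S' := by
        have := mul_le_mul_of_nonneg_right hj1 hS0
        have := mul_le_mul_of_nonneg_right hj2 hSp'.le
        linarith
      have h2 : S' * (s' j - s j) ≤ S' * (Δ / 2) := by
        have : S' * (s' j - s j) ≤ s' j * Δ := by rw [hΔ]; linarith
        have h3 : s' j * Δ ≤ S' / 2 * Δ := mul_le_mul_of_nonneg_right (by linarith) hΔ0.le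
        linarith
      exact le_of_mul_le_mul_left h2 hSp'
    have e1 := Finset.add_sum_erase Finset.univ (fun i => s' i - s i) (Finset.mem_univ j)
    have e2 := Finset.add_sum_erase Finset.univ (fun i => a i / (3 * M) * Δ) (Finset.mem_univ j)
    have e3 : ∑ i ∈ Finset.univ.erase j, (s' i - s i) ≤
        ∑ i ∈ Finset.univ.erase j, a i / (3 * M) * Δ :=
      Finset.sum_le_sum fun i hi => hoth i (Finset.ne_of_mem_erase hi)
    simp only [Finset.sum_sub_distrib, hS, hS'] at e1 e2 e3
    linarith [hc0 j]

lemma sum_upd {n : ℕ} (s : Fin n → ℝ) (i : Fin n) (x : ℝ) :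
    ∑ j, Function.update s i x j = x + (∑ j, s j - s i) := by
  rw [Finset.sum_update_of_mem (Finset.mem_univ i),
    ← Finset.add_sum_erase Finset.univ s (Finset.mem_univ i), Finset.sdiff_singleton_eq_erase]
  ring

lemma obj_upd_s6 {n : ℕ} (r : ℝ) (h : Fin n → ℝ) (f : ℝ → ℝ) (s : Fin n → ℝ) (i : Fin n) (x : ℝ) :
    obj n r h (vwap n f) i (Function.update s i x) =
      x * (1 - Fv f (x + (∑ j, s j - s i))) + r * (h i - x * Fv f (x + (∑ j, s j - s i))) := by
  rw [← sum_upd]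
  simp [obj, vwap, Fv]

lemma obj_self_s6 {n : ℕ} (r : ℝ) (h : Fin n → ℝ) (f : ℝ → ℝ) (s : Fin n → ℝ) (i : Fin n) :
    obj n r h (vwap n f) i s =
      s i * (1 - Fv f (∑ j, s j)) + r * (h i - s i * Fv f (∑ j, s j)) := rfl

lemma obj_iff {r hi s x F X : ℝ} (hr : 0 ≤ r) :
    s * (1 - F) + r * (hi - s * F) ≤ x * (1 - X) + r * (hi - x * X) ↔
      x * X - s * F ≤ (1 / (1 + r)) * (x - s) := by
  have : 0 < 1 + r := by linarith
  rw [div_mul_eq_mul_div, le_div_iff₀ this]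
  constructor <;> intro h <;> linarith

lemma F_cont {M : ℝ} {f : ℝ → ℝ} (hf : Assumption2 M f) : ContinuousOn (Fv f) (Set.Icc 0 M) := by
  set K := |((1/2) * derivWithin f (Set.Icc 0 M) 0)| with hK
  have h1 : ∀ x ∈ Set.Icc 0 M, ∀ y ∈ Set.Icc 0 M, x ≤ y → |Fv f x - Fv f y| ≤ K * (y - x) := by
    intro x hx y hy hxy
    have h2 := F_lip hf hx.1 hxy hy.2
    have h3 : 0 ≤ Fv f x - Fv f y := by
      rcases hxy.eq_or_lt with rfl | h
      · simp
      · linarith [F_anti hf hx.1 h hy.2]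
    rw [abs_of_nonneg h3]
    refine h2.trans (mul_le_mul_of_nonneg_right (neg_le_abs _) (by linarith))
  have : LipschitzOnWith (Real.toNNReal K) (Fv f) (Set.Icc 0 M) := by
    apply LipschitzOnWith.of_dist_le_mul
    intro x hx y hy
    rw [Real.coe_toNNReal _ (abs_nonneg _), Real.dist_eq, Real.dist_eq]
    rcases le_total x y with h | h
    · rw [abs_sub_comm x y, abs_of_nonneg (by linarith : 0 ≤ y - x)]
      exact h1 x hx y hy h
    · rw [abs_sub_comm, abs_of_nonneg (by linarith : 0 ≤ x - y)]
      exact h1 y hy x hx h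
  exact this.continuousOn

lemma H_cont {M : ℝ} {f : ℝ → ℝ} (hf : Assumption2 M f) {c s : ℝ} {I : Set ℝ}
    (hI : ∀ x ∈ I, x + c ∈ Set.Icc 0 M) (hS : 0 < s + c) (hSM : s + c ≤ M) :
    ContinuousWithinAt (fun x => Fv f (x + c) - x * ((Fv f (x + c) - f (x + c)) / (x + c))) I s := by
  have c1 : ContinuousWithinAt (fun x => x + c) I s := by fun_prop
  have cF : ContinuousWithinAt (fun x => Fv f (x + c)) I s :=
    ContinuousWithinAt.comp (t := Set.Icc 0 M) (g := Fv f) (f := fun x => x + c)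
      (F_cont hf (s + c) ⟨hS.le, hSM⟩) c1 hI
  have cf : ContinuousWithinAt (fun x => f (x + c)) I s :=
    ContinuousWithinAt.comp (t := Set.Icc 0 M) (g := f) (f := fun x => x + c)
      (hf.smooth.continuousOn (s + c) ⟨hS.le, hSM⟩) c1 hI
  exact cF.sub (continuousWithinAt_id.mul ((cF.sub cf).div c1 hS.ne'))

lemma nash_kkt (n : ℕ) (hn : 0 < n) (a h : Fin n → ℝ) (r M : ℝ) (f g : ℝ → ℝ) (hr : 0 ≤ r)
    (hh : ∀ i, 0 < h i)
    (hM : ∑ i, a i ≤ M) (hf : Assumption2 M f)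
    (hU : ∀ S ∈ Set.Icc (0 : ℝ) (∑ i, a i), ∀ i, h i / Fv f S ≤ a i)
    (s : Fin n → ℝ) (hs : memD n a s)
    (hN : NashP2 n a h r (g (∑ i, s i)) (fun _ => Fv f (∑ i, s i)) (vwap n f) s) :
    KKT n a h (1 / (1 + r)) f g s (∑ i, s i) := by
  have hS0 : 0 ≤ ∑ i, s i := Finset.sum_nonneg fun i _ => (hs i).1
  have hSA : ∑ i, s i ≤ ∑ i, a i := Finset.sum_le_sum fun i _ => (hs i).2
  have hUS := hU _ ⟨hS0, hSA⟩
  have hsS : ∀ i, s i ≤ ∑ i, s i := fun i =>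
    Finset.single_le_sum (fun j _ => (hs j).1) (Finset.mem_univ i)
  have hcA : ∀ i x, x ≤ a i → x + (∑ j, s j - s i) ≤ M := by
    intro i x hx
    rw [← sum_upd]
    refine le_trans (Finset.sum_le_sum fun j _ => ?_) hM
    by_cases hj : j = i
    · subst hj; simpa using hx
    · simpa [hj] using (hs j).2
  set S := ∑ i, s i with hS
  have hSM : S ≤ M := by linarith
  have hFp := F_pos hf hS0 hSM
  set ρ := 1 / (1 + r) with hρ
  have hfe : ∀ i, feasP2 n a h (g S) (fun _ => Fv f S) i (s i) := by
    intro i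
    refine ((hN i).1 ?_).1
    have := hUS i
    rwa [div_le_iff₀ hFp] at this
  have hop : ∀ i x, 0 ≤ x → x ≤ h i / Fv f S → (h i - a i * g S) / (Fv f S - g S) ≤ x →
      x * Fv f (x + (S - s i)) - s i * Fv f S ≤ ρ * (x - s i) := by
    intro i x h0 hu hl
    have h1 := ((hN i).1 (by
      have := hUS i
      rwa [div_le_iff₀ hFp] at this)).2 x ⟨⟨h0, hu.trans (hUS i)⟩, hu, hl⟩
    rw [obj_upd_s6, obj_self_s6, ← hS] at h1
    exact (obj_iff hr).1 h1
  refine ⟨fun i => ⟨(hs i).1, (hs i).2, (hfe i).2.1, (hfe i).2.2⟩, ?_, ?_⟩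
  · intro h0
    have i : Fin n := ⟨0, hn⟩
    have hsi : s i = 0 := le_antisymm ((hsS i).trans h0.le) (hs i).1
    have hup : 0 < h i / Fv f S := div_pos (hh i) hFp
    have hx : ∀ x ∈ Set.Ioo 0 (h i / Fv f S), Fv f x ≤ ρ := by
      intro x hx
      have := hop i x hx.1.le hx.2.le (by have := (hfe i).2.2; rw [hsi] at this; linarith [hx.1])
      rw [hsi, h0] at this
      simp only [sub_zero, add_zero, zero_mul] at this
      have : x * Fv f x ≤ x * ρ := by linarith
      exact le_of_mul_le_mul_left this hx.1
    have := ContinuousWithinAt.closure_le (s := Set.Ioo 0 (h i / Fv f S)) (x := 0)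
      (f := Fv f) (g := fun _ => ρ) (by rw [closure_Ioo hup.ne]; exact ⟨le_rfl, hup.le⟩)
      ((F_cont hf 0 ⟨le_rfl, by linarith⟩).mono (by
        intro x hx
        have h1 := hcA i x (hx.2.le.trans (hUS i))
        rw [hsi, h0] at h1
        exact ⟨hx.1.le, by linarith⟩)) continuousWithinAt_const hx
    rwa [F_zero] at this
  · intro hSp i
    have hd : 0 < (Fv f S - f S) / S := div_pos (by linarith [F_gt hf hSp hSM]) hSp
    have hsc : s i + (S - s i) = S := by ring
    have hc : 0 ≤ S - s i := by linarith [hsS i]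
    constructor
    · intro h0 hl
      set L := max 0 ((h i - a i * g S) / (Fv f S - g S)) with hL
      have hLs : L < s i := max_lt h0 hl
      have hx : ∀ x ∈ Set.Ioo L (s i), ρ ≤ Fv f (x + (S - s i)) -
          x * ((Fv f (x + (S - s i)) - f (x + (S - s i))) / (x + (S - s i))) := by
        intro x hx
        have hx0 : 0 < x := lt_of_le_of_lt (le_max_left _ _) hx.1
        have h1 := hop i x hx0.le (hx.2.le.trans (hfe i).2.1) ((le_max_right _ _).trans hx.1.le)
        have h2 := proceeds_tangent hf (s := x) (x := s i) hc h0.le (by linarith)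
          (by linarith [hx.2]) (by linarith)
        rw [hsc] at h2
        have h3 : (s i - x) * ρ ≤ (s i - x) * (Fv f (x + (S - s i)) -
          x * ((Fv f (x + (S - s i)) - f (x + (S - s i))) / (x + (S - s i)))) := by linarith
        exact le_of_mul_le_mul_left h3 (by linarith [hx.2])
      have := ContinuousWithinAt.closure_le (s := Set.Ioo L (s i)) (x := s i)
        (f := fun _ => ρ) (by rw [closure_Ioo hLs.ne]; exact ⟨hLs.le, le_rfl⟩)
        continuousWithinAt_const (H_cont hf (c := S - s i) (by
          intro x hx
          have hx0 : 0 < x := lt_of_le_of_lt (le_max_left _ _) hx.1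
          exact ⟨by linarith, by linarith [hx.2]⟩) (by linarith) (by linarith)) hx
      rw [hsc] at this
      unfold tv
      rw [le_div_iff₀ hd]
      linarith
    · intro hu
      have hx : ∀ x ∈ Set.Ioo (s i) (h i / Fv f S), Fv f (x + (S - s i)) -
          x * ((Fv f (x + (S - s i)) - f (x + (S - s i))) / (x + (S - s i))) ≤ ρ := by
        intro x hx
        have h1 := hop i x ((hs i).1.trans hx.1.le) hx.2.le ((hfe i).2.2.trans hx.1.le)
        have h2 := proceeds_tangent hf (s := x) (x := s i) hc (hs i).1 (by linarith [hx.1])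
          (hcA i x (hx.2.le.trans (hUS i))) (by linarith)
        rw [hsc] at h2
        have h3 : (x - s i) * (Fv f (x + (S - s i)) -
          x * ((Fv f (x + (S - s i)) - f (x + (S - s i))) / (x + (S - s i)))) ≤ (x - s i) * ρ := by
          linarith
        exact le_of_mul_le_mul_left h3 (by linarith [hx.1])
      have := ContinuousWithinAt.closure_le (s := Set.Ioo (s i) (h i / Fv f S)) (x := s i)
        (g := fun _ => ρ) (by rw [closure_Ioo hu.ne]; exact ⟨le_rfl, hu.le⟩)
        (H_cont hf (c := S - s i) (by
          intro x hx
          exact ⟨by linarith [hx.1], hcA i x (hx.2.le.trans (hUS i))⟩)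
          (by linarith) (by linarith)) continuousWithinAt_const hx
      rw [hsc] at this
      unfold tv
      rw [div_le_iff₀ hd]
      linarith

lemma verify (n : ℕ) (a h : Fin n → ℝ) (r M : ℝ) (f g : ℝ → ℝ) (hr : 0 ≤ r)
    (hM : ∑ i, a i ≤ M) (hf : Assumption2 M f)
    (hU : ∀ S ∈ Set.Icc (0 : ℝ) (∑ i, a i), ∀ i, h i / Fv f S ≤ a i)
    (s : Fin n → ℝ) (S : ℝ) (hSs : ∑ i, s i = S)
    (hs : ∀ i, 0 ≤ s i ∧ s i ≤ h i / Fv f S ∧ (h i - a i * g S) / (Fv f S - g S) ≤ s i)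
    (hSA : S ∈ Set.Icc 0 (∑ i, a i))
    (h0 : S = 0 → r = 0)
    (hopt : 0 < S → ∀ i x, 0 ≤ x → x ≤ h i / Fv f S → (h i - a i * g S) / (Fv f S - g S) ≤ x →
      0 ≤ (x - s i) * (1 / (1 + r) - Fv f S + s i * ((Fv f S - f S) / S))) :
    ClearingVWAP n a h r f g (g S) (fun _ => Fv f S) := by
  have hUS := hU S hSA
  have hS0 : 0 ≤ S := hSA.1
  have hSM : S ≤ M := by linarith [hSA.2]
  have hFp := F_pos hf hS0 hSM
  have hsD : memD n a s := fun i => ⟨(hs i).1, (hs i).2.1.trans (hUS i)⟩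
  have hsS : ∀ i, s i ≤ S := fun i => by
    rw [← hSs]
    exact Finset.single_le_sum (fun j _ => (hs j).1) (Finset.mem_univ i)
  have hcA : ∀ i x, x ≤ a i → x + (S - s i) ≤ M := by
    intro i x hx
    rw [← hSs, ← sum_upd]
    refine le_trans (Finset.sum_le_sum fun j _ => ?_) hM
    by_cases hj : j = i
    · subst hj; simpa using hx
    · simpa [hj] using (hsD j).2
  refine ⟨s, hsD, ?_, by rw [hSs], fun i => by simp only [vwap, Fv, hSs]⟩
  intro i
  refine ⟨fun _ => ⟨⟨hsD i, (hs i).2.1, (hs i).2.2⟩, ?_⟩, ?_⟩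
  · intro x hx
    have hx0 : 0 ≤ x := hx.1.1
    have hxa : x ≤ a i := hx.1.2
    rw [obj_upd_s6, obj_self_s6, hSs, obj_iff hr]
    rcases hS0.eq_or_lt with h00 | hSp
    · have hsi : s i = 0 := le_antisymm ((hsS i).trans h00.symm.le) (hs i).1
      rw [h0 h00.symm, hsi, ← h00]
      have hx1 := hcA i x hxa
      rw [hsi, ← h00] at hx1
      simp only [sub_zero, add_zero, zero_mul, div_one, one_mul] at hx1 ⊢
      rcases hx0.eq_or_lt with hz | hz
      · rw [← hz]; simp
      · nlinarith [F_lt_one hf hz hx1]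
    · have h2 := proceeds_tangent hf (c := S - s i) (s := s i) (x := x) (by linarith [hsS i]) hx0
        (by linarith) (by linarith) (hcA i x hxa)
      have hsc : s i + (S - s i) = S := by ring
      rw [hsc] at h2
      have h3 := hopt hSp i x hx0 hx.2.1 hx.2.2
      linarith
  · intro hlt
    have := hUS i
    rw [div_le_iff₀ hFp] at this
    linarith

lemma ivt_clip (n : ℕ) (a h : Fin n → ℝ) (M ε : ℝ) (f g T : ℝ → ℝ)
    (hM : ∑ i, a i ≤ M) (hf : Assumption2 M f) (hg : ContinuousOn g (Set.Icc 0 M))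
    (hgF : ∀ S ∈ Set.Icc (0 : ℝ) (∑ i, a i), g S < Fv f S)
    (hU : ∀ S ∈ Set.Icc (0 : ℝ) (∑ i, a i), ∀ i, h i / Fv f S ≤ a i)
    (hε : 0 ≤ ε) (hεA : ε ≤ ∑ i, a i) (hT : ContinuousOn T (Set.Icc ε (∑ i, a i)))
    (hstart : ε ≤ ∑ i, min (max (max 0 ((h i - a i * g ε) / (Fv f ε - g ε))) (T ε))
      (h i / Fv f ε)) :
    ∃ S ∈ Set.Icc ε (∑ i, a i), 
      ∑ i, min (max (max 0 ((h i - a i * g S) / (Fv f S - g S))) (T S)) (h i / Fv f S) = S := by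
  have hsub : Set.Icc ε (∑ i, a i) ⊆ Set.Icc 0 M := Set.Icc_subset_Icc hε hM
  have cF := (F_cont hf).mono hsub
  have cg := hg.mono hsub
  have hFp : ∀ S ∈ Set.Icc ε (∑ i, a i), Fv f S ≠ 0 := fun S hS =>
    (F_pos hf (hsub hS).1 (hsub hS).2).ne'
  have hD : ∀ S ∈ Set.Icc ε (∑ i, a i), Fv f S - g S ≠ 0 := fun S hS => by
    have := hgF S ⟨hε.trans hS.1, hS.2⟩
    linarith
  have hc : ContinuousOn (fun S => S - ∑ i, min (max (max 0 ((h i - a i * g S) / (Fv f S - g S)))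
      (T S)) (h i / Fv f S)) (Set.Icc ε (∑ i, a i)) := by
    apply continuousOn_id.sub
    apply continuousOn_finsetSum
    intro i _
    refine ContinuousOn.inf (ContinuousOn.sup (ContinuousOn.sup continuousOn_const ?_) hT) ?_
    · exact (continuousOn_const.sub (continuousOn_const.mul cg)).div (cF.sub cg) hD
    · exact continuousOn_const.div cF hFp
  have := intermediate_value_Icc hεA hc
  obtain ⟨S, hS, hS2⟩ := this (a := (0:ℝ)) ⟨by simpa using hstart, by
    simp only [sub_nonneg]
    refine Finset.sum_le_sum fun i _ => (min_le_right _ _).trans (hU _ ⟨hε.trans hεA, le_rfl⟩ i)⟩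
  exact ⟨S, hS, by simp only at hS2; linarith⟩

lemma LU {a h F G : ℝ} (hG : 0 < G) (hGF : G < F) (ha : h / F ≤ a) :
    (h - a * G) / (F - G) ≤ h / F := by
  have hF : 0 < F := by linarith
  rw [div_le_iff₀ hF] at ha
  rw [div_le_div_iff₀ (by linarith) hF]
  nlinarith

lemma exist (n : ℕ) (hn : 0 < n) (a h : Fin n → ℝ) (r M : ℝ) (f g : ℝ → ℝ) (hr : 0 ≤ r)
    (ha : ∀ i, 0 < a i) (hh : ∀ i, 0 < h i)
    (hM : ∑ i, a i ≤ M) (hf : Assumption2 M f) (hg : ContinuousOn g (Set.Icc 0 M))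
    (hg_mem : ∀ x ∈ Set.Icc (0 : ℝ) M, 0 < g x)
    (hgF : ∀ S ∈ Set.Icc (0 : ℝ) (∑ i, a i), g S < Fv f S)
    (hU : ∀ S ∈ Set.Icc (0 : ℝ) (∑ i, a i), ∀ i, h i / Fv f S ≤ a i) :
    ∃ S, ClearingVWAP n a h r f g (g S) (fun _ => Fv f S) := by
  have i0 : Fin n := ⟨0, hn⟩
  have hA0 : 0 < ∑ i, a i := Finset.sum_pos (fun i _ => ha i) ⟨i0, Finset.mem_univ _⟩
  have hFpos : ∀ S ∈ Set.Icc (0 : ℝ) (∑ i, a i), 0 < Fv f S := fun S hS =>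
    F_pos hf hS.1 (hS.2.trans hM)
  have hLU : ∀ S ∈ Set.Icc (0 : ℝ) (∑ i, a i), ∀ i,
      max 0 ((h i - a i * g S) / (Fv f S - g S)) ≤ h i / Fv f S := by
    intro S hS i
    refine max_le (div_pos (hh i) (hFpos S hS)).le ?_
    exact LU (hg_mem S ⟨hS.1, hS.2.trans hM⟩) (hgF S hS) (hU S hS i)
  rcases hr.eq_or_lt with hr0 | hrp
  · obtain ⟨S, hS, hS2⟩ := ivt_clip n a h M 0 f g (fun _ => 0) hM hf hg hgF hU le_rfl hA0.le
      continuousOn_const (Finset.sum_nonneg fun i _ => by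
        refine le_min (le_max_right _ _) ?_
        exact (div_pos (hh i) (hFpos 0 ⟨le_rfl, hA0.le⟩)).le)
    have hcl : ∀ i, min (max (max 0 ((h i - a i * g S) / (Fv f S - g S))) 0) (h i / Fv f S)
        = max 0 ((h i - a i * g S) / (Fv f S - g S)) := by
      intro i
      rw [max_eq_left (le_max_left 0 _), min_eq_left (hLU S hS i)]
    simp only [hcl] at hS2
    refine ⟨S, verify n a h r M f g hr hM hf hU _ S hS2
      (fun i => ⟨le_max_left _ _, hLU S hS i, le_max_right _ _⟩) hS (fun _ => hr0.symm) ?_⟩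
    intro hSp i x hx0 hxu hxl
    have hSM := hS.2.trans hM
    have hd : 0 < (Fv f S - f S) / S := div_pos (by linarith [F_gt hf hSp hSM]) hSp
    apply mul_nonneg
    · linarith [max_le hx0 hxl]
    · have := F_lt_one hf hSp hSM
      have h2 : 0 ≤ max 0 ((h i - a i * g S) / (Fv f S - g S)) * ((Fv f S - f S) / S) :=
        mul_nonneg (le_max_left _ _) hd.le
      rw [← hr0]
      norm_num
      linarith
  · set ρ := 1 / (1 + r) with hρ
    have hρ1 : ρ < 1 := by rw [hρ, div_lt_one (by linarith)]; linarith
    obtain ⟨ε, hε, hεA, hεh, hεf⟩ : ∃ ε, 0 < ε ∧ ε ≤ ∑ i, a i ∧ ε ≤ h i0 ∧ ρ ≤ f ε := by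
      set p := |derivWithin f (Set.Icc 0 M) 0| with hp
      have hp0 : 0 ≤ p := abs_nonneg _
      refine ⟨min (min (∑ i, a i) (h i0)) ((1 - ρ) / (p + 1)), ?_, ?_, ?_, ?_⟩
      · exact lt_min (lt_min hA0 (hh i0)) (div_pos (by linarith) (by linarith))
      · exact (min_le_left _ _).trans (min_le_left _ _)
      · exact (min_le_left _ _).trans (min_le_right _ _)
      · set ε := min (min (∑ i, a i) (h i0)) ((1 - ρ) / (p + 1)) with hεd
        have e0 : 0 < ε := lt_min (lt_min hA0 (hh i0)) (div_pos (by linarith) (by linarith))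
        have e1 : ε ≤ ∑ i, a i := (min_le_left _ _).trans (min_le_left _ _)
        have e2 : ε ≤ (1 - ρ) / (p + 1) := min_le_right _ _
        rw [le_div_iff₀ (by linarith)] at e2
        have e3 := lip0 (A2_convex hf) (hf.smooth.differentiableOn (by norm_num)) le_rfl e0.le
          (e1.trans hM)
        rw [hf.f_zero] at e3
        have e4 : - derivWithin f (Set.Icc 0 M) 0 * (ε - 0) ≤ p * (ε - 0) :=
          mul_le_mul_of_nonneg_right (neg_le_abs _) (by linarith)
        linarith
    have hsub : Set.Icc ε (∑ i, a i) ⊆ Set.Icc 0 M := Set.Icc_subset_Icc hε.le hM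
    have hdp : ∀ S ∈ Set.Icc ε (∑ i, a i), 0 < (Fv f S - f S) / S := fun S hS => by
      have hSp : 0 < S := lt_of_lt_of_le hε hS.1
      exact div_pos (by linarith [F_gt hf hSp (hS.2.trans hM)]) hSp
    have cF := (F_cont hf).mono hsub
    have cT : ContinuousOn (tv f ρ) (Set.Icc ε (∑ i, a i)) := by
      unfold tv
      refine (cF.sub continuousOn_const).div ((cF.sub (hf.smooth.continuousOn.mono hsub)).div
        continuousOn_id (fun S hS => ?_)) (fun S hS => (hdp S hS).ne')
      exact (lt_of_lt_of_le hε hS.1).ne'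
    have hεm : ε ∈ Set.Icc (0 : ℝ) (∑ i, a i) := ⟨hε.le, hεA⟩
    obtain ⟨S, hS, hS2⟩ := ivt_clip n a h M ε f g (tv f ρ) hM hf hg hgF hU hε.le hεA cT (by
      have hdε := hdp ε ⟨le_rfl, hεA⟩
      have h1 : ε ≤ min (max (max 0 ((h i0 - a i0 * g ε) / (Fv f ε - g ε))) (tv f ρ ε))
          (h i0 / Fv f ε) := by
        refine le_min (le_trans ?_ (le_max_right _ _)) ?_
        · unfold tv
          rw [le_div_iff₀ hdε, mul_div_cancel₀ _ hε.ne']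
          linarith
        · rw [le_div_iff₀ (hFpos ε hεm)]
          have := F_lt_one hf hε (hεA.trans hM)
          nlinarith [hFpos ε hεm]
      refine h1.trans (Finset.single_le_sum (f := fun i => min (max (max 0 ((h i - a i * g ε) /
        (Fv f ε - g ε))) (tv f ρ ε)) (h i / Fv f ε)) (fun i _ => ?_) (Finset.mem_univ i0))
      exact le_min ((le_max_left _ _).trans (le_max_left _ _))
        (div_pos (hh i) (hFpos ε hεm)).le)
    have hSm : S ∈ Set.Icc (0 : ℝ) (∑ i, a i) := ⟨hε.le.trans hS.1, hS.2⟩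
    have hSp : 0 < S := lt_of_lt_of_le hε hS.1
    refine ⟨S, verify n a h r M f g hr hM hf hU _ S hS2 (fun i => ⟨?_, min_le_right _ _, ?_⟩) hSm
      (fun h0 => absurd h0 hSp.ne') ?_⟩
    · exact le_min ((le_max_left _ _).trans (le_max_left _ _))
        (div_pos (hh i) (hFpos S hSm)).le
    · exact le_min ((le_max_right _ _).trans (le_max_left _ _))
        ((le_max_right _ _).trans (hLU S hSm i))
    · intro _ i x hx0 hxu hxl
      have hd := hdp S hS
      have hLUi := hLU S hSm i
      have hLx : max 0 ((h i - a i * g S) / (Fv f S - g S)) ≤ x := max_le hx0 hxl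
      have het : tv f ρ S * ((Fv f S - f S) / S) = Fv f S - ρ := by
        unfold tv
        rw [div_mul_cancel₀ _ hd.ne']
      set d := (Fv f S - f S) / S
      set t := tv f ρ S
      set L := max 0 ((h i - a i * g S) / (Fv f S - g S))
      set U := h i / Fv f S
      have e : (x - min (max L t) U) * (ρ - Fv f S + min (max L t) U * d) =
        d * ((x - min (max L t) U) * (min (max L t) U - t)) := by
        linear_combination (x - min (max L t) U) * het
      rw [e]
      apply mul_nonneg hd.le
      rcases le_total U t with h1 | h1
      · rw [min_eq_right (h1.trans (le_max_right _ _))]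
        exact mul_nonneg_of_nonpos_of_nonpos (by linarith) (by linarith)
      · rw [min_eq_left (max_le hLUi h1)]
        rcases le_total t L with h2 | h2
        · rw [max_eq_left h2]
          exact mul_nonneg (by linarith) (by linarith)
        · rw [max_eq_right h2]; simp

/-- under VWAP pricing, Assumption 2, Assumptions 1(3)-1(4) on a continuously
differentiable haircut `g`, fundamental solvency of all banks, and the contraction condition
`-3M·min((1/2)f'(0), g'(0)) < min_j min_{s ∈ D} (f̄ⱼ(s) − g(∑ sᵢ))`, the clearing price
vector is unique. -/
theorem vwap_unique_clearing_prices
    (n : ℕ) (a h : Fin n → ℝ) (r M : ℝ) (f g : ℝ → ℝ)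
    (ha : ∀ i, 0 < a i) (hh : ∀ i, 0 < h i) (hr : 0 ≤ r)
    (hM : ∑ i, a i ≤ M)
    (hf : Assumption2 M f)
    (hg_mem : ∀ x ∈ Set.Icc (0 : ℝ) M, g x ∈ Set.Ioc (0 : ℝ) 1)
    (hg_smooth : ContDiffOn ℝ 1 g (Set.Icc 0 M))
    (hg_convex : ConvexOn ℝ (Set.Icc 0 M) g)
    (hg_anti : StrictAntiOn g (Set.Icc 0 M))
    (hg_lt : ∀ s, memD n a s → ∀ i, g (∑ j, s j) < vwap n f i s)
    (hg_total_mono : ∀ i s, memD n a s →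
      StrictMonoOn
        (fun x => x * vwap n f i (Function.update s i x)
          + (a i - x) * g (∑ j, Function.update s i x j)) (Set.Icc 0 (a i)))
    (hsolv : ∀ i, h i ≤ a i * vwap n f i a)
    (hcond : ∀ j : Fin n, ∀ s : Fin n → ℝ, memD n a s →
      -3 * M * min ((1/2) * derivWithin f (Set.Icc 0 M) 0)
          (derivWithin g (Set.Icc 0 M) 0)
        < vwap n f j s - g (∑ i, s i)) :
    ∃! p : ℝ × (Fin n → ℝ), ClearingVWAP n a h r f g p.1 p.2 := by
  rcases Nat.eq_zero_or_pos n with hn | hn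
  · subst hn
    refine ⟨(g 0, fun _ => 0), ⟨fun _ => 0, fun i => i.elim0, fun i => i.elim0, by simp,
      fun i => i.elim0⟩, ?_⟩
    rintro ⟨q, qb⟩ ⟨s, _, _, hq, _⟩
    refine Prod.ext ?_ (Subsingleton.elim _ _)
    simpa using hq
  have i0 : Fin n := ⟨0, hn⟩
  have hA0 : 0 < ∑ i, a i := Finset.sum_pos (fun i _ => ha i) ⟨i0, Finset.mem_univ _⟩
  have hM0 : 0 < M := by linarith
  have hex : ∀ S ∈ Set.Icc (0 : ℝ) (∑ i, a i), ∃ s, memD n a s ∧ ∑ i, s i = S := by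
    intro S hS
    refine ⟨fun i => S / (∑ j, a j) * a i, fun i => ⟨?_, ?_⟩, ?_⟩
    · exact mul_nonneg (div_nonneg hS.1 hA0.le) (ha i).le
    · exact mul_le_of_le_one_left (ha i).le ((div_le_one hA0).2 hS.2)
    · rw [← Finset.mul_sum]; field_simp
  have hgF : ∀ S ∈ Set.Icc (0 : ℝ) (∑ i, a i), g S < Fv f S := by
    intro S hS
    obtain ⟨s, hs, rfl⟩ := hex S hS
    exact hg_lt s hs i0
  set K := - min ((1/2) * derivWithin f (Set.Icc 0 M) 0) (derivWithin g (Set.Icc 0 M) 0) with hKd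
  have hK : ∀ S ∈ Set.Icc (0 : ℝ) (∑ i, a i), 3 * M * K < Fv f S - g S := by
    intro S hS
    obtain ⟨s, hs, rfl⟩ := hex S hS
    have : -3 * M * min ((1/2) * derivWithin f (Set.Icc 0 M) 0) (derivWithin g (Set.Icc 0 M) 0)
      < Fv f (∑ i, s i) - g (∑ i, s i) := hcond i0 s hs
    rw [hKd]; linarith
  have hFl : ∀ S T, 0 ≤ S → S ≤ T → T ≤ M → Fv f S - Fv f T ≤ K * (T - S) := by
    intro S T h0 hST hT
    refine (F_lip hf h0 hST hT).trans (mul_le_mul_of_nonneg_right ?_ (by linarith))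
    exact neg_le_neg (min_le_left _ _)
  have hgl : ∀ S T, 0 ≤ S → S ≤ T → T ≤ M → g S - g T ≤ K * (T - S) := by
    intro S T h0 hST hT
    refine (lip0 hg_convex (hg_smooth.differentiableOn (by norm_num)) h0 hST hT).trans
      (mul_le_mul_of_nonneg_right ?_ (by linarith))
    exact neg_le_neg (min_le_right _ _)
  have hU : ∀ S ∈ Set.Icc (0 : ℝ) (∑ i, a i), ∀ i, h i / Fv f S ≤ a i := by
    intro S hS i
    rw [div_le_iff₀ (F_pos hf hS.1 (hS.2.trans hM))]
    have h1 : h i ≤ a i * Fv f (∑ j, a j) := hsolv i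
    refine h1.trans (mul_le_mul_of_nonneg_left ?_ (ha i).le)
    rcases hS.2.eq_or_lt with h2 | h2
    · rw [h2]
    · exact (F_anti hf hS.1 h2 hM).le
  have hgp : ∀ x ∈ Set.Icc (0 : ℝ) M, 0 < g x := fun x hx => (hg_mem x hx).1
  obtain ⟨S, hS⟩ := exist n hn a h r M f g hr ha hh hM hf hg_smooth.continuousOn hgp hgF hU
  -- every clearing vector comes from a KKT point
  have hkk : ∀ q qb, ClearingVWAP n a h r f g q qb → ∃ s, 
      KKT n a h (1 / (1 + r)) f g s (∑ i, s i) ∧ q = g (∑ i, s i) ∧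
        qb = fun _ => Fv f (∑ i, s i) := by
    rintro q qb ⟨s, hs, hN, hq, hqb⟩
    have hqb' : qb = fun _ => Fv f (∑ i, s i) := funext fun i => hqb i
    subst hq
    subst hqb'
    exact ⟨s, nash_kkt n hn a h r M f g hr hh hM hf hU s hs hN, rfl, rfl⟩
  refine ⟨(g S, fun _ => Fv f S), hS, ?_⟩
  rintro ⟨q, qb⟩ hp
  obtain ⟨s, k, hq, hqb⟩ := hkk _ _ hS
  obtain ⟨s', k', hq', hqb'⟩ := hkk _ _ hp
  have : ∑ i, s' i = ∑ i, s i := by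
    rcases lt_trichotomy (∑ i, s' i) (∑ i, s i) with h1 | h1 | h1
    · exact (kkt_unique_aux n hn a h M K _ f g ha hh hM hM0 hf hgp hgF hK hFl hgl hU s' s _ _
        rfl rfl k' k h1).elim
    · exact h1
    · exact (kkt_unique_aux n hn a h M K _ f g ha hh hM hM0 hf hgp hgF hK hFl hgl hU s s' _ _
        rfl rfl k k' h1).elim
  simp only at hq hqb hq' hqb'
  refine Prod.ext ?_ ?_
  · simp only; rw [hq', hq, this]
  · simp only; rw [hqb', hqb, this]
end
end
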